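/- arXiv:1708.06825 — 8 statements merged into one kernel-verified Lean document; each statement's English description precedes it below -/
import Mathlib

section
/- For every n ∈ ℕ, the Hermite function g_n : ℝ → ℝ defined by g_n(x) = He_n(√2·x)·exp(−x²/2) is an eigenfunction of the one-dimensional harmonic oscillator with eigenvalue n + 1/2: for all x ∈ ℝ, (1/2)·(−g_n''(x) + x²·g_n(x)) = (n + 1/2)·g_n(x). -/
/-- Hermite's differential equation for the probabilists' Hermite polynomials. -/
theorem derivative_derivative_hermite (n : ℕ) :
    Polynomial.derivative (Polynomial.derivative (Polynomial.hermite n)) =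
      Polynomial.X * Polynomial.derivative (Polynomial.hermite n) -
        (n : Polynomial ℤ) * Polynomial.hermite n := by
  induction n with
  | zero => simp
  | succ n ih =>
    have h : Polynomial.derivative (Polynomial.hermite (n + 1)) =
        ((n + 1 : ℕ) : Polynomial ℤ) * Polynomial.hermite n := by
      rw [Polynomial.hermite_succ, Polynomial.derivative_sub, Polynomial.derivative_mul, ih,
        Polynomial.derivative_X]
      push_cast
      ring
    rw [h, Polynomial.derivative_mul, Polynomial.derivative_natCast, Polynomial.hermite_succ]
    ring

theorem hasDerivAt_exp_neg_sq_div_two (x : ℝ) :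
    HasDerivAt (fun x : ℝ => Real.exp (-(x ^ 2) / 2)) (-x * Real.exp (-(x ^ 2) / 2)) x := by
  convert ((((hasDerivAt_id' x).fun_pow 2).fun_neg).div_const 2).exp using 1
  ring

theorem hasDerivAt_aeval_const_mul (p : Polynomial ℤ) (c x : ℝ) :
    HasDerivAt (fun x : ℝ => (Polynomial.aeval (c * x) p : ℝ))
      (c * Polynomial.aeval (c * x) (Polynomial.derivative p)) x := by
  have h := (p.hasDerivAt_aeval (c * x)).comp x ((hasDerivAt_id x).const_mul c)
  rw [mul_one, mul_comm] at h
  exact h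

/-- The Hermite function `g_n(x) = He_n(√2 x) e^{-x²/2}` is an eigenfunction of the
one-dimensional harmonic oscillator with eigenvalue `n + 1/2`. -/
theorem statement5 (n : ℕ) (g : ℝ → ℝ)
    (hg : ∀ x : ℝ, g x =
      (Polynomial.aeval (Real.sqrt 2 * x) (Polynomial.hermite n) : ℝ) *
        Real.exp (-(x ^ 2) / 2)) :
    ∀ x : ℝ, (1 / 2) * (-(deriv (deriv g) x) + x ^ 2 * g x) = ((n : ℝ) + 1 / 2) * g x := by
  intro x
  have hderiv : deriv g = fun x => (Real.sqrt 2 * Polynomial.aeval (Real.sqrt 2 * x)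
      (Polynomial.derivative (Polynomial.hermite n)) -
        x * Polynomial.aeval (Real.sqrt 2 * x) (Polynomial.hermite n)) *
          Real.exp (-(x ^ 2) / 2) := by
    rw [funext hg]
    funext x
    rw [((hasDerivAt_aeval_const_mul (Polynomial.hermite n) (Real.sqrt 2) x).fun_mul
      (hasDerivAt_exp_neg_sq_div_two x)).deriv]
    ring
  have hderiv2 := (((hasDerivAt_aeval_const_mul (Polynomial.derivative (Polynomial.hermite n))
    (Real.sqrt 2) x).const_mul (Real.sqrt 2)).fun_sub ((hasDerivAt_id' x).fun_mul
      (hasDerivAt_aeval_const_mul (Polynomial.hermite n) (Real.sqrt 2) x))).fun_mul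
        (hasDerivAt_exp_neg_sq_div_two x)
  rw [hderiv, hderiv2.deriv, hg, derivative_derivative_hermite]
  simp only [map_sub, map_mul, map_natCast, Polynomial.aeval_X]
  have hsqrt : Real.sqrt 2 * Real.sqrt 2 = 2 := Real.mul_self_sqrt (by norm_num)
  generalize Polynomial.aeval (Real.sqrt 2 * x) (Polynomial.hermite n) = u
  generalize Polynomial.aeval (Real.sqrt 2 * x)
    (Polynomial.derivative (Polynomial.hermite n)) = v
  generalize Real.exp (-(x ^ 2) / 2) = e
  linear_combination (-(1 / 2) * (Real.sqrt 2 * x * v - n * u) * e) * hsqrt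
end

section
/- Fix d ≥ 1 and a multiindex α : Fin d → ℕ with |α| = Σ_j α_j. The product Hermite function ψ_α(x) = (Π_{j} He_{α_j}(√2·x_j))·exp(−|x|²/2) on ℝ^d is an eigenfunction of the d-dimensional harmonic oscillator H₀ = (1/2)(−Δ + |x|²) with eigenvalue |α| + d/2: for all x ∈ ℝ^d, (1/2)·(−Σ_{j=1}^{d} ∂²ψ_α/∂x_j²(x) + |x|²·ψ_α(x)) = (|α| + d/2)·ψ_α(x). -/
open Polynomial in
theorem Polynomial.derivative_derivative_hermite (n : ℕ) :
    derivative (derivative (hermite n)) = X * derivative (hermite n) - (n : ℤ[X]) * hermite n := by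
  induction n with
  | zero => simp
  | succ n ih =>
    have h : derivative (hermite (n + 1)) = ((n : ℤ[X]) + 1) * hermite n := by
      rw [hermite_succ, derivative_sub, derivative_mul, derivative_X, ih]
      ring
    have h2 : derivative (derivative (hermite (n + 1))) =
        ((n : ℤ[X]) + 1) * derivative (hermite n) := by
      rw [h, derivative_mul]
      simp
    rw [h2, h, hermite_succ]
    push_cast
    ring

/-- The one-dimensional Hermite function `He_n(√2 t) e^{-t²/2}`. -/
noncomputable def hermiteFunction (n : ℕ) (t : ℝ) : ℝ :=
  Polynomial.aeval (Real.sqrt 2 * t) (Polynomial.hermite n) * Real.exp (-t ^ 2 / 2)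

theorem hasDerivAt_aeval_mul_exp_neg_sq (p : Polynomial ℤ) (t : ℝ) :
    HasDerivAt (fun t : ℝ => Polynomial.aeval (Real.sqrt 2 * t) p * Real.exp (-t ^ 2 / 2))
      ((Real.sqrt 2 * Polynomial.aeval (Real.sqrt 2 * t) (Polynomial.derivative p) -
        t * Polynomial.aeval (Real.sqrt 2 * t) p) * Real.exp (-t ^ 2 / 2)) t := by
  have hlin : HasDerivAt (fun t : ℝ => Real.sqrt 2 * t) (Real.sqrt 2) t := by
    simpa using (hasDerivAt_id t).const_mul (Real.sqrt 2)
  have hp := (p.hasDerivAt_aeval (Real.sqrt 2 * t)).comp t hlin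
  have hexp : HasDerivAt (fun t : ℝ => -t ^ 2 / 2) (-t) t := by
    refine ((hasDerivAt_pow 2 t).neg.div_const 2).congr_deriv ?_
    push_cast
    ring
  refine (hp.mul hexp.exp).congr_deriv ?_
  simp only [Function.comp_apply]
  ring

theorem deriv_deriv_hermiteFunction (n : ℕ) (t : ℝ) :
    deriv (deriv (hermiteFunction n)) t = (t ^ 2 - (2 * n + 1)) * hermiteFunction n t := by
  set p := Polynomial.hermite n with hp
  have hderiv : deriv (hermiteFunction n) = fun t : ℝ =>
      Real.sqrt 2 * (Polynomial.aeval (Real.sqrt 2 * t) (Polynomial.derivative p) *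
        Real.exp (-t ^ 2 / 2)) -
      t * (Polynomial.aeval (Real.sqrt 2 * t) p * Real.exp (-t ^ 2 / 2)) := by
    funext s
    refine (hasDerivAt_aeval_mul_exp_neg_sq p s).deriv.trans ?_
    ring
  have hsecond :=
    ((hasDerivAt_aeval_mul_exp_neg_sq (Polynomial.derivative p) t).const_mul (Real.sqrt 2)).sub
      ((hasDerivAt_id' t).mul (hasDerivAt_aeval_mul_exp_neg_sq p t))
  rw [hderiv]
  refine hsecond.deriv.trans ?_
  have hsq : Real.sqrt 2 * Real.sqrt 2 = 2 := Real.mul_self_sqrt (by norm_num)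
  rw [hermiteFunction, hp, Polynomial.derivative_derivative_hermite, ← hp]
  simp only [map_sub, map_mul, map_natCast, Polynomial.aeval_X]
  linear_combination (Real.sqrt 2 * t * Polynomial.aeval (Real.sqrt 2 * t) (Polynomial.derivative p)
    - n * Polynomial.aeval (Real.sqrt 2 * t) p) * Real.exp (-t ^ 2 / 2) * hsq

theorem deriv_deriv_prod_update {ι : Type*} [Fintype ι] [DecidableEq ι] (f : ι → ℝ → ℝ)
    (x : ι → ℝ) (j : ι) (s : ℝ) :
    deriv (deriv fun t : ℝ => ∏ i, f i (Function.update x j t i)) s =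
      deriv (deriv (f j)) s * ∏ i ∈ Finset.univ.erase j, f i (x i) := by
  have hfac : (fun t : ℝ => ∏ i, f i (Function.update x j t i)) =
      fun t => f j t * ∏ i ∈ Finset.univ.erase j, f i (x i) := by
    funext t
    rw [← Finset.mul_prod_erase _ _ (Finset.mem_univ j), Function.update_self]
    congr 1
    refine Finset.prod_congr rfl fun i hi => ?_
    rw [Function.update_of_ne (Finset.ne_of_mem_erase hi)]
  simp only [hfac, deriv_mul_const_field']


/-- The product Hermite function `ψ_α(x) = (∏_j He_{α_j}(√2 x_j)) e^{-|x|²/2}` on `ℝ^d`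
is an eigenfunction of the harmonic oscillator `H₀ = (1/2)(-Δ + |x|²)` with eigenvalue
`|α| + d/2`. -/
theorem statement6 (d : ℕ) (hd : 1 ≤ d) (α : Fin d → ℕ)
    (ψ : (Fin d → ℝ) → ℝ)
    (hψ : ∀ x : Fin d → ℝ, ψ x =
      (∏ j, (Polynomial.aeval (Real.sqrt 2 * x j) (Polynomial.hermite (α j)) : ℝ)) *
        Real.exp (-(∑ j, (x j) ^ 2) / 2)) :
    ∀ x : Fin d → ℝ,
      (1 / 2) * (-(∑ j, deriv (deriv (fun t : ℝ => ψ (Function.update x j t))) (x j)) +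
          (∑ j, (x j) ^ 2) * ψ x) =
        ((∑ j, α j : ℕ) + (d : ℝ) / 2) * ψ x := by
  have hprod : ∀ x, ψ x = ∏ j, hermiteFunction (α j) (x j) := by
    intro x
    simp only [hψ, hermiteFunction, Finset.prod_mul_distrib, ← Real.exp_sum,
      ← Finset.sum_div, Finset.sum_neg_distrib]
  intro x
  have hderiv : ∀ j, deriv (deriv fun t : ℝ => ψ (Function.update x j t)) (x j) =
      ((x j) ^ 2 - (2 * α j + 1)) * ψ x := by
    intro j
    simp only [hprod]
    rw [deriv_deriv_prod_update (fun i => hermiteFunction (α i)), deriv_deriv_hermiteFunction,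
      mul_assoc, Finset.mul_prod_erase _ (fun i => hermiteFunction (α i) (x i)) (Finset.mem_univ j)]
  simp only [hderiv, ← Finset.sum_mul, Finset.sum_sub_distrib, Finset.sum_add_distrib,
    ← Finset.mul_sum, Finset.sum_const, Finset.card_univ, Fintype.card_fin, nsmul_eq_mul]
  push_cast
  ring
end

section
/- Fix d ≥ 1 and let t ∈ ℝ with cos(t) ≠ 0. The Mehler phase φ₂ satisfies the Hamilton–Jacobi (eikonal) equation for the harmonic oscillator Hamiltonian p₂(x, ξ) = (|x|² + |ξ|²)/2: for all x, η ∈ ℝ^d, ∂_t φ₂(t, x, η) + (1/2)·(|∇_x φ₂(t, x, η)|² + |x|²) = 0, and moreover φ₂(0, x, η) = ⟨x, η⟩. -/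
open Real
open scoped RealInnerProductSpace

theorem hasDerivAt_mehlerPhase {t : ℝ} (ht : Real.cos t ≠ 0) (a b : ℝ) :
    HasDerivAt (fun s => (1 / Real.cos s) * (a - Real.sin s * b))
      ((Real.sin t * a - b) / Real.cos t ^ 2) t := by
  have h := ((hasDerivAt_const t (1 : ℝ)).div (Real.hasDerivAt_cos t) ht).mul
    (((Real.hasDerivAt_sin t).mul_const b).const_sub a)
  refine h.congr_deriv ?_
  simp only [Pi.div_apply]
  field_simp
  linear_combination -b * Real.sin_sq_add_cos_sq t

theorem hasGradientAt_mehlerPhase {E : Type*} [NormedAddCommGroup E] [InnerProductSpace ℝ E]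
    [CompleteSpace E] (c s : ℝ) (x η : E) :
    HasGradientAt (fun y : E => c * (⟪y, η⟫ - s * ((‖y‖ ^ 2 + ‖η‖ ^ 2) / 2)))
      (c • (η - s • x)) x := by
  rw [hasGradientAt_iff_hasFDerivAt]
  have hinner : HasFDerivAt (fun y : E => ⟪y, η⟫) (innerSL ℝ η) x := by
    exact (innerSL ℝ η).hasFDerivAt.congr_of_eventuallyEq
      (.of_forall fun y => real_inner_comm η y)
  have hnorm : HasFDerivAt (fun y : E => ‖y‖ ^ 2) (2 • innerSL ℝ x) x :=
    (hasStrictFDerivAt_norm_sq x).hasFDerivAt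
  have h := (hinner.sub (((hnorm.add_const (‖η‖ ^ 2)).mul_const (1 / 2)).const_mul s)).const_mul c
  simp only [mul_one_div] at h
  refine h.congr_fderiv ?_
  ext v
  simp

theorem norm_sq_smul_sub_smul {E : Type*} [NormedAddCommGroup E] [InnerProductSpace ℝ E]
    (c s : ℝ) (x η : E) :
    ‖c • (η - s • x)‖ ^ 2 = c ^ 2 * (‖η‖ ^ 2 - 2 * s * ⟪x, η⟫ + s ^ 2 * ‖x‖ ^ 2) := by
  rw [norm_smul, mul_pow, norm_sub_sq_real, norm_smul, mul_pow, real_inner_smul_right,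
    real_inner_comm, Real.norm_eq_abs, Real.norm_eq_abs, sq_abs, sq_abs]
  ring

/-- The Mehler phase `φ₂(t,x,η) = sec t (⟨x,η⟩ - sin t (|x|² + |η|²)/2)` satisfies the
Hamilton–Jacobi (eikonal) equation `∂_t φ₂ + (1/2)(|∇_x φ₂|² + |x|²) = 0` for the harmonic
oscillator, with `φ₂(0,x,η) = ⟨x,η⟩`. -/
theorem statement8 (d : ℕ) (hd : 1 ≤ d) (t : ℝ) (ht : Real.cos t ≠ 0)
    (φ₂ : ℝ → EuclideanSpace ℝ (Fin d) → EuclideanSpace ℝ (Fin d) → ℝ)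
    (hφ₂ : ∀ (s : ℝ) (x η : EuclideanSpace ℝ (Fin d)),
      φ₂ s x η = (1 / Real.cos s) * (⟪x, η⟫ - Real.sin s * ((‖x‖ ^ 2 + ‖η‖ ^ 2) / 2))) :
    ∀ x η : EuclideanSpace ℝ (Fin d),
      (deriv (fun s => φ₂ s x η) t +
        (1 / 2) * (‖gradient (fun y => φ₂ t y η) x‖ ^ 2 + ‖x‖ ^ 2) = 0) ∧
      φ₂ 0 x η = ⟪x, η⟫ := by
  intro x η
  refine ⟨?_, by simp [hφ₂]⟩
  simp only [hφ₂]
  rw [(hasDerivAt_mehlerPhase ht _ _).deriv, (hasGradientAt_mehlerPhase _ _ x η).gradient,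
    norm_sq_smul_sub_smul]
  field_simp
  linear_combination ‖x‖ ^ 2 * Real.sin_sq_add_cos_sq t
end

section
/- Fix d ≥ 1 and let t ∈ ℝ with cos(t) ≠ 0. The Mehler phase φ₂ is a generating function of the harmonic oscillator flow: for all x, η ∈ ℝ^d, Φ_t(∇_η φ₂(t, x, η), η) = (x, ∇_x φ₂(t, x, η)), where ∇_x φ₂ and ∇_η φ₂ denote the gradients in the x and η variables respectively. -/
open Real
open scoped RealInnerProductSpace

/-- The gradient of `y ↦ c * (⟪a, y⟫ - s * ((‖a‖² + ‖y‖²) / 2))` at `y` is `c • (a - s • y)`. -/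
theorem hasGradientAt_mul_inner_sub_norm_sq {E : Type*} [NormedAddCommGroup E]
    [InnerProductSpace ℝ E] [CompleteSpace E] (c s : ℝ) (a y : E) :
    HasGradientAt (fun z => c * (⟪a, z⟫ - s * ((‖a‖ ^ 2 + ‖z‖ ^ 2) / 2)))
      (c • (a - s • y)) y := by
  rw [hasGradientAt_iff_hasFDerivAt]
  have h_inner : HasFDerivAt (fun z : E => ⟪a, z⟫) (innerSL ℝ a) y := (innerSL ℝ a).hasFDerivAt
  have h_norm : HasFDerivAt (fun z : E => ‖z‖ ^ 2) (2 • innerSL ℝ y) y :=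
    (hasStrictFDerivAt_norm_sq y).hasFDerivAt
  have h :=
    (h_inner.sub (((h_norm.const_add (‖a‖ ^ 2)).mul_const (2⁻¹ : ℝ)).const_mul s)).const_mul c
  simp only [div_eq_mul_inv]
  refine h.congr_fderiv ?_
  ext v
  simp

/-- The Mehler phase `φ₂` is a generating function of the harmonic oscillator flow:
`Φ_t(∇_η φ₂(t,x,η), η) = (x, ∇_x φ₂(t,x,η))`. -/
theorem statement9 (d : ℕ) (hd : 1 ≤ d) (t : ℝ) (ht : Real.cos t ≠ 0)
    (Φ : ℝ → EuclideanSpace ℝ (Fin d) × EuclideanSpace ℝ (Fin d) →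
      EuclideanSpace ℝ (Fin d) × EuclideanSpace ℝ (Fin d))
    (hΦ : ∀ s p, Φ s p =
      (Real.cos s • p.1 + Real.sin s • p.2, Real.cos s • p.2 - Real.sin s • p.1))
    (φ₂ : ℝ → EuclideanSpace ℝ (Fin d) → EuclideanSpace ℝ (Fin d) → ℝ)
    (hφ₂ : ∀ (s : ℝ) (x η : EuclideanSpace ℝ (Fin d)),
      φ₂ s x η = (1 / Real.cos s) * (⟪x, η⟫ - Real.sin s * ((‖x‖ ^ 2 + ‖η‖ ^ 2) / 2))) :
    ∀ x η : EuclideanSpace ℝ (Fin d),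
      Φ t (gradient (fun ζ => φ₂ t x ζ) η, η) = (x, gradient (fun y => φ₂ t y η) x) := by
  intro x η
  have h_eta : gradient (fun ζ => φ₂ t x ζ) η = (1 / cos t) • (x - sin t • η) := by
    simp only [hφ₂]
    exact (hasGradientAt_mul_inner_sub_norm_sq _ _ x η).gradient
  have h_x : gradient (fun y => φ₂ t y η) x = (1 / cos t) • (η - sin t • x) := by
    simp only [hφ₂, real_inner_comm η, add_comm _ (‖η‖ ^ 2)]
    exact (hasGradientAt_mul_inner_sub_norm_sq _ _ η x).gradient
  rw [hΦ, h_eta, h_x, Prod.mk.injEq]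
  constructor
  · rw [smul_smul, mul_one_div_cancel ht, one_smul, sub_add_cancel]
  · have h := sin_sq_add_cos_sq t
    match_scalars
    · field_simp
      linarith
    · field_simp
end

section
/- Mehler's formula: fix d ≥ 1 and let u₀ be a Schwartz function on ℝ^d with Fourier transform û₀(η) = ∫_{ℝ^d} e^{−i⟨y,η⟩} u₀(y) dy. For t ∈ (−π/2, π/2) define u(t, x) = (2π)^{−d}·(cos t)^{−d/2}·∫_{ℝ^d} e^{i·φ₂(t, x, η)} û₀(η) dη. Then u is smooth on (−π/2, π/2) × ℝ^d, u(0, x) = u₀(x) for all x, and u solves the Schrödinger equation for the isotropic harmonic oscillator: i·∂_t u(t, x) = (1/2)·(−Σ_{j=1}^{d} ∂²u/∂x_j²(t, x) + |x|²·u(t, x)) for all t ∈ (−π/2, π/2) and x ∈ ℝ^d. -/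
open Real MeasureTheory
open scoped Real
open scoped FourierTransform SchwartzMap

theorem SchwartzMap.exists_pi_fourier (d : ℕ) (u₀ : SchwartzMap (Fin d → ℝ) ℂ) :
    ∃ g : SchwartzMap (Fin d → ℝ) ℂ,
      (∀ η, g η = ∫ y : Fin d → ℝ, Complex.exp (-(Complex.I * (∑ j, y j * η j))) * u₀ y) ∧
      ∀ x, (((2 * π) ^ d)⁻¹ : ℂ) *
        ∫ η : Fin d → ℝ, Complex.exp (Complex.I * (∑ j, x j * η j)) * g η = u₀ x := by
  let e := EuclideanSpace.equiv (Fin d) ℝ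
  let v : 𝓢(EuclideanSpace ℝ (Fin d), ℂ) := SchwartzMap.compCLMOfContinuousLinearEquiv ℂ e u₀
  let s : (Fin d → ℝ) ≃L[ℝ] (Fin d → ℝ) :=
    ContinuousLinearEquiv.smulLeft (Units.mk0 ((2 * π)⁻¹ : ℝ) (by positivity))
  let g : 𝓢(Fin d → ℝ, ℂ) :=
    SchwartzMap.compCLMOfContinuousLinearEquiv ℂ (s.trans e.symm) (𝓕 v)
  have hg : ∀ η, g η = 𝓕 v (WithLp.toLp 2 ((2 * π)⁻¹ • η)) := fun η => rfl
  refine ⟨g, fun η => ?_, fun x => ?_⟩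
  · rw [hg, SchwartzMap.fourier_coe, Real.fourier_eq',
      ← (PiLp.volume_preserving_toLp (Fin d)).integral_comp
        (MeasurableEquiv.toLp 2 (Fin d → ℝ)).measurableEmbedding]
    refine integral_congr_ae (.of_forall fun y => ?_)
    have hy : v (WithLp.toLp 2 y) = u₀ y := rfl
    simp only [smul_eq_mul, hy]
    congr 2
    simp [PiLp.inner_apply, Finset.mul_sum, Finset.sum_mul]
    refine Finset.sum_congr rfl fun j _ => ?_
    field_simp
  · have hv : u₀ x = 𝓕⁻ (𝓕 v) (WithLp.toLp 2 x) := by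
      rw [FourierTransform.fourierInv_fourier_eq]; rfl
    rw [hv, SchwartzMap.fourierInv_coe, Real.fourierInv_eq',
      ← (PiLp.volume_preserving_toLp (Fin d)).integral_comp
        (MeasurableEquiv.toLp 2 (Fin d → ℝ)).measurableEmbedding]
    have := Measure.integral_comp_inv_smul_of_nonneg (volume : Measure (Fin d → ℝ))
      (fun ξ : Fin d → ℝ => Complex.exp (Complex.I * (∑ j, x j * ((2 * π) * ξ j))) *
        𝓕 v (WithLp.toLp 2 ξ)) (R := 2 * π) (by positivity)
    have h2 : (∫ η : Fin d → ℝ, Complex.exp (Complex.I * (∑ j, x j * η j)) * g η) =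
        ∫ η : Fin d → ℝ, Complex.exp (Complex.I * (∑ j, x j *
          ((2 * π) * ((2 * π)⁻¹ • η) j : ℝ))) * 𝓕 v (WithLp.toLp 2 ((2 * π)⁻¹ • η)) := by
      refine integral_congr_ae (.of_forall fun η => ?_)
      simp only [hg]
      congr 4
      refine Finset.sum_congr rfl fun j _ => ?_
      simp only [Pi.smul_apply, smul_eq_mul]
      field_simp
    rw [h2, this, Module.finrank_fin_fun, Complex.real_smul, ← mul_assoc]
    rw [show ((2 * (π : ℂ)) ^ d)⁻¹ * (((2 * π) ^ d : ℝ) : ℂ) = 1 by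
      push_cast; exact inv_mul_cancel₀ (pow_ne_zero _ (by simp [pi_ne_zero])), one_mul]
    refine integral_congr_ae (.of_forall fun y => ?_)
    simp only [smul_eq_mul, SchwartzMap.fourier_coe]
    congr 2
    simp [PiLp.inner_apply, Finset.mul_sum, Finset.sum_mul]
    refine Finset.sum_congr rfl fun j _ => ?_
    ring

theorem hasDerivAt_integral_exp_I_mul {α : Type*} [MeasurableSpace α] {μ : Measure α}
    {p : α → ℝ} {h : α → ℂ} (hp : AEStronglyMeasurable p μ) (hh : Integrable h μ)
    (hph : Integrable (fun a => (p a : ℂ) * h a) μ) (s : ℝ) :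
    HasDerivAt (fun s : ℝ => ∫ a, Complex.exp (Complex.I * (s * p a : ℝ)) * h a ∂μ)
      (Complex.I * ∫ a, Complex.exp (Complex.I * (s * p a : ℝ)) * (p a * h a) ∂μ) s := by
  have hm (s : ℝ) : AEStronglyMeasurable
      (fun a => Complex.exp (Complex.I * (s * p a : ℝ))) μ := by
    have : Continuous fun r : ℝ => Complex.exp (Complex.I * (s * r : ℝ)) := by fun_prop
    exact this.comp_aestronglyMeasurable hp
  have hn (r : ℝ) : ‖Complex.exp (Complex.I * r)‖ = 1 := by
    rw [mul_comm]; exact Complex.norm_exp_ofReal_mul_I r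
  rw [← integral_const_mul]
  refine (hasDerivAt_integral_of_dominated_loc_of_deriv_le (Filter.univ_mem)
    (F := fun (s : ℝ) a => Complex.exp (Complex.I * (s * p a : ℝ)) * h a)
    (F' := fun (s : ℝ) a => Complex.I * (Complex.exp (Complex.I * (s * p a : ℝ)) * (p a * h a)))
    (bound := fun a => ‖(p a : ℂ) * h a‖)
    (.of_forall fun s => (hm s).mul hh.1) ?_ ?_ (.of_forall fun a s _ => ?_) hph.norm
    (.of_forall fun a s _ => ?_)).2
  · exact hh.bdd_mul (c := 1) (hm s) (.of_forall fun a => (hn _).le)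
  · exact ((hm s).mul hph.1).const_mul _
  · simp only [norm_mul, Complex.norm_I, hn, one_mul]; exact le_rfl
  · have h1 : HasDerivAt (fun s : ℝ => Complex.I * ((s * p a : ℝ) : ℂ))
        (Complex.I * ((1 * p a : ℝ) : ℂ)) s :=
      (((hasDerivAt_id s).mul_const (p a)).ofReal_comp).const_mul _
    exact (h1.cexp.mul_const (h a)).congr_deriv (by push_cast; ring)

/-- The pairing `(a, x), (b, y) ↦ a b + ∑ j, x j y j`, as a continuous bilinear map. -/
noncomputable def prodPiPairing (d : ℕ) :
    ℝ × (Fin d → ℝ) →L[ℝ] ℝ × (Fin d → ℝ) →L[ℝ] ℝ :=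
  (ContinuousLinearMap.mul ℝ ℝ).bilinearComp (.fst ..) (.fst ..) +
    ∑ j, (ContinuousLinearMap.mul ℝ ℝ).bilinearComp
      ((ContinuousLinearMap.proj j).comp (.snd ..)) ((ContinuousLinearMap.proj j).comp (.snd ..))

theorem prodPiPairing_apply {d : ℕ} (v w : ℝ × (Fin d → ℝ)) :
    prodPiPairing d v w = v.1 * w.1 + ∑ j, v.2 j * w.2 j := by
  simp [prodPiPairing]

theorem SchwartzMap.integrable_sum_sq_pow {d : ℕ} (g : SchwartzMap (Fin d → ℝ) ℂ) (n : ℕ) :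
    Integrable fun η : Fin d → ℝ => ‖((∑ j, η j ^ 2, η) : ℝ × (Fin d → ℝ))‖ ^ n * ‖g η‖ := by
  have hc : Continuous fun η : Fin d → ℝ => ((∑ j, η j ^ 2, η) : ℝ × (Fin d → ℝ)) := by fun_prop
  refine (((g.integrable_pow_mul volume n).add (g.integrable_pow_mul volume (2 * n))).const_mul
    ((d + 1 : ℝ) ^ n)).mono' (by fun_prop) (.of_forall fun η => ?_)
  have h1 : ∑ j, η j ^ 2 ≤ d * ‖η‖ ^ 2 := by
    have : ∀ j ∈ Finset.univ, η j ^ 2 ≤ ‖η‖ ^ 2 := fun j _ =>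
      sq_le_sq.2 (by simpa using norm_le_pi_norm η j)
    simpa using Finset.sum_le_sum this
  have h0 : 0 ≤ ∑ j, η j ^ 2 := Finset.sum_nonneg fun j _ => sq_nonneg _
  have hr := norm_nonneg η
  have hd : (0 : ℝ) ≤ d := d.cast_nonneg
  have h2 : ‖((∑ j, η j ^ 2, η) : ℝ × (Fin d → ℝ))‖ ^ n ≤
      (d + 1 : ℝ) ^ n * (‖η‖ ^ n + ‖η‖ ^ (2 * n)) := by
    rw [pow_mul, Prod.norm_mk, Real.norm_of_nonneg h0]
    rcases le_total (∑ j, η j ^ 2) ‖η‖ with h | h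
    · calc _ ≤ (1 : ℝ) ^ n * ‖η‖ ^ n := by rw [max_eq_right h]; simp
        _ ≤ _ := by gcongr <;> [linarith; exact le_add_of_nonneg_right (by positivity)]
    · calc _ ≤ (d * ‖η‖ ^ 2) ^ n := by rw [max_eq_left h]; gcongr
        _ = (d : ℝ) ^ n * (‖η‖ ^ 2) ^ n := mul_pow _ _ _
        _ ≤ _ := by gcongr <;> [linarith; exact le_add_of_nonneg_left (by positivity)]
  have h3 := mul_le_mul_of_nonneg_right h2 (norm_nonneg (g η))
  rw [Real.norm_of_nonneg (by positivity)]
  simp only [Pi.add_apply]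
  linarith

/-- The integral `∫ exp (i (b |η|² + ⟨a, η⟩)) g η dη` as a function of `(b, a)`. -/
noncomputable def oscillatoryIntegral {d : ℕ} (g : SchwartzMap (Fin d → ℝ) ℂ)
    (w : ℝ × (Fin d → ℝ)) : ℂ :=
  ∫ η : Fin d → ℝ, Complex.exp (Complex.I * (w.1 * ∑ j, η j ^ 2 + ∑ j, w.2 j * η j : ℝ)) * g η

theorem contDiff_oscillatoryIntegral {d : ℕ} (g : SchwartzMap (Fin d → ℝ) ℂ) :
    ContDiff ℝ (⊤ : ℕ∞) (oscillatoryIntegral g) := by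
  have hg := g.continuous
  have hq : Continuous fun η : Fin d → ℝ => ((∑ j, η j ^ 2, η) : ℝ × (Fin d → ℝ)) := by fun_prop
  have key := VectorFourier.contDiff_fourierIntegral (N := ⊤) (f := fun v => g v.2)
    (μ := volume.map fun η : Fin d → ℝ => ((∑ j, η j ^ 2, η) : ℝ × (Fin d → ℝ)))
    (-(2 * π)⁻¹ • prodPiPairing d) fun n _ => by
      rw [integrable_map_measure _ hq.aemeasurable]
      · exact g.integrable_sum_sq_pow n
      · exact Continuous.aestronglyMeasurable (by fun_prop)
  have heq : oscillatoryIntegral g = VectorFourier.fourierIntegral 𝐞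
      (volume.map fun η : Fin d → ℝ => ((∑ j, η j ^ 2, η) : ℝ × (Fin d → ℝ)))
      (-(2 * π)⁻¹ • prodPiPairing d).toLinearMap₁₂ (fun v => g v.2) := by
    funext w
    simp only [oscillatoryIntegral, VectorFourier.fourierIntegral]
    rw [integral_map hq.aemeasurable]
    · refine integral_congr_ae (.of_forall fun η => ?_)
      simp [prodPiPairing_apply, Circle.smul_def, Real.fourierChar_apply]
      left
      congr 1
      field_simp
      simp only [mul_comm]
    · refine Continuous.aestronglyMeasurable ?_
      refine Continuous.smul
        (continuous_subtype_val.comp (Real.continuous_fourierChar.comp ?_)) (by fun_prop)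
      change Continuous fun v => -((-(2 * π)⁻¹ • prodPiPairing d) v w)
      fun_prop
  rw [heq]
  exact key

/-- Multiplication of a Schwartz function by the `j`-th coordinate. -/
noncomputable def coordMul {d : ℕ} (j : Fin d) (g : SchwartzMap (Fin d → ℝ) ℂ) :
    SchwartzMap (Fin d → ℝ) ℂ :=
  SchwartzMap.smulLeftCLM ℂ (fun η : Fin d → ℝ => η j) g

theorem coordMul_apply {d : ℕ} (j : Fin d) (g : SchwartzMap (Fin d → ℝ) ℂ) (η : Fin d → ℝ) :
    coordMul j g η = η j * g η := by
  have : (fun η : Fin d → ℝ => η j).HasTemperateGrowth :=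
    (ContinuousLinearMap.proj (R := ℝ) (φ := fun _ : Fin d => ℝ) j).hasTemperateGrowth
  rw [coordMul, SchwartzMap.smulLeftCLM_apply_apply this, Complex.real_smul]

theorem integrable_oscillatoryIntegral {d : ℕ} (g : SchwartzMap (Fin d → ℝ) ℂ)
    (w : ℝ × (Fin d → ℝ)) :
    Integrable fun η : Fin d → ℝ =>
      Complex.exp (Complex.I * (w.1 * ∑ j, η j ^ 2 + ∑ j, w.2 j * η j : ℝ)) * g η :=
  g.integrable.bdd_mul (c := 1) (Continuous.aestronglyMeasurable (by fun_prop))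
    (.of_forall fun η => by rw [mul_comm, Complex.norm_exp_ofReal_mul_I])

theorem hasDerivAt_oscillatoryIntegral {d : ℕ} (g : SchwartzMap (Fin d → ℝ) ℂ)
    {γ : ℝ → ℝ × (Fin d → ℝ)} {γ' : ℝ × (Fin d → ℝ)} {t : ℝ} (hγ : HasDerivAt γ γ' t) :
    HasDerivAt (fun s => oscillatoryIntegral g (γ s))
      (Complex.I * (γ'.1 * ∑ j, oscillatoryIntegral (coordMul j (coordMul j g)) (γ t) +
        ∑ j, γ'.2 j * oscillatoryIntegral (coordMul j g) (γ t))) t := by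
  have hd : DifferentiableAt ℝ (oscillatoryIntegral g) (γ t) :=
    (contDiff_oscillatoryIntegral g).differentiable (by simp) _
  refine (hd.hasFDerivAt.comp_hasDerivAt t hγ).congr_deriv ?_
  have hl : HasDerivAt (fun s : ℝ => γ t + s • γ') γ' 0 := by
    simpa using ((hasDerivAt_id (0 : ℝ)).smul_const γ').const_add (γ t)
  have h1 : HasDerivAt (fun s : ℝ => oscillatoryIntegral g (γ t + s • γ'))
      (fderiv ℝ (oscillatoryIntegral g) (γ t) γ') 0 := by
    have hd' : HasFDerivAt (oscillatoryIntegral g) (fderiv ℝ (oscillatoryIntegral g) (γ t))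
      (γ t + (0 : ℝ) • γ') := by simpa using hd.hasFDerivAt
    exact hd'.comp_hasDerivAt (0 : ℝ) hl
  set e : (Fin d → ℝ) → ℂ := fun η =>
    Complex.exp (Complex.I * ((γ t).1 * ∑ j, η j ^ 2 + ∑ j, (γ t).2 j * η j : ℝ)) with he
  have hi1 (j : Fin d) : Integrable fun η => e η * (coordMul j g η) :=
    integrable_oscillatoryIntegral (coordMul j g) (γ t)
  have hi2 (j : Fin d) : Integrable fun η => e η * (coordMul j (coordMul j g) η) :=
    integrable_oscillatoryIntegral (coordMul j (coordMul j g)) (γ t)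
  have hexp (η : Fin d → ℝ) : ((γ'.1 * ∑ j, η j ^ 2 + ∑ j, γ'.2 j * η j : ℝ) : ℂ) * (e η * g η) =
      γ'.1 * ∑ j, e η * (coordMul j (coordMul j g) η) + ∑ j, γ'.2 j * (e η * coordMul j g η) := by
    simp only [coordMul_apply]
    push_cast
    simp only [add_mul, Finset.mul_sum, Finset.sum_mul]
    congr 1 <;> exact Finset.sum_congr rfl fun j _ => by ring
  have hint : Integrable fun η : Fin d → ℝ =>
      ((γ'.1 * ∑ j, η j ^ 2 + ∑ j, γ'.2 j * η j : ℝ) : ℂ) * (e η * g η) := by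
    simp only [hexp]
    exact ((integrable_finsetSum _ fun j _ => hi2 j).const_mul _).add
      (integrable_finsetSum _ fun j _ => (hi1 j).const_mul _)
  have h2 := hasDerivAt_integral_exp_I_mul (μ := volume)
    (p := fun η : Fin d → ℝ => γ'.1 * ∑ j, η j ^ 2 + ∑ j, γ'.2 j * η j)
    (h := fun η => e η * g η) (Continuous.aestronglyMeasurable (by fun_prop))
    (integrable_oscillatoryIntegral g (γ t)) hint 0
  have heq : (fun s : ℝ => oscillatoryIntegral g (γ t + s • γ')) = fun s : ℝ =>
      ∫ η : Fin d → ℝ, Complex.exp (Complex.I *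
        (s * (γ'.1 * ∑ j, η j ^ 2 + ∑ j, γ'.2 j * η j) : ℝ)) * (e η * g η) := by
    funext s
    refine integral_congr_ae (.of_forall fun η => ?_)
    simp only [he, ← mul_assoc, ← Complex.exp_add]
    congr 2
    rw [← mul_add, ← Complex.ofReal_add]
    congr 2
    simp [add_mul, Finset.sum_add_distrib, ← Finset.mul_sum, mul_assoc]
    ring
  rw [heq] at h1
  rw [h1.unique h2]
  simp only [zero_mul, Complex.ofReal_zero, mul_zero, Complex.exp_zero, one_mul, hexp]
  rw [integral_add ((integrable_finsetSum _ fun j _ => hi2 j).const_mul _)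
    (integrable_finsetSum _ fun j _ => (hi1 j).const_mul _), integral_const_mul,
    integral_finsetSum _ fun j _ => hi2 j,
    integral_finsetSum _ fun j _ => (hi1 j).const_mul _]
  simp only [integral_const_mul]
  rfl

/-- The integral `∫ exp (i φ₂(t, x, η)) g η dη`, with the Gaussian factor in `x` pulled out. -/
noncomputable def mehlerIntegral {d : ℕ} (g : SchwartzMap (Fin d → ℝ) ℂ) (t : ℝ)
    (x : Fin d → ℝ) : ℂ :=
  Complex.exp (Complex.I * (-(tan t / 2) * ∑ j, x j ^ 2 : ℝ)) *
    oscillatoryIntegral g (-(tan t / 2), (cos t)⁻¹ • x)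

theorem mehlerIntegral_eq {d : ℕ} (g : SchwartzMap (Fin d → ℝ) ℂ) (t : ℝ) (x : Fin d → ℝ) :
    mehlerIntegral g t x = ∫ η : Fin d → ℝ, Complex.exp (Complex.I *
      ((1 / cos t) * ((∑ j, x j * η j) -
        sin t * ((∑ j, (x j) ^ 2 + ∑ j, (η j) ^ 2) / 2)) : ℝ)) * g η := by
  rw [mehlerIntegral, oscillatoryIntegral, ← integral_const_mul]
  refine integral_congr_ae (.of_forall fun η => ?_)
  simp only [← mul_assoc, ← Complex.exp_add]
  congr 2
  rw [← mul_add, ← Complex.ofReal_add]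
  congr 2
  simp only [Pi.smul_apply, smul_eq_mul, mul_assoc, ← Finset.mul_sum, tan_eq_sin_div_cos]
  ring

theorem contDiffOn_mehlerIntegral {d : ℕ} (g : SchwartzMap (Fin d → ℝ) ℂ) :
    ContDiffOn ℝ (⊤ : ℕ∞) (fun p : ℝ × (Fin d → ℝ) => mehlerIntegral g p.1 p.2)
      {p | cos p.1 ≠ 0} := by
  have ht : ContDiffOn ℝ (⊤ : ℕ∞) (fun p : ℝ × (Fin d → ℝ) => tan p.1) {p | cos p.1 ≠ 0} := by
    simp only [tan_eq_sin_div_cos]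
    exact ContDiffOn.div (by fun_prop) (by fun_prop) fun p hp => hp
  have hc : ContDiffOn ℝ (⊤ : ℕ∞) (fun p : ℝ × (Fin d → ℝ) => (cos p.1)⁻¹) {p | cos p.1 ≠ 0} :=
    ContDiffOn.inv (by fun_prop) fun p hp => hp
  unfold mehlerIntegral
  refine ContDiffOn.mul (ContDiffOn.cexp (contDiffOn_const.mul ?_)) ?_
  · refine Complex.ofRealCLM.contDiff.comp_contDiffOn (ContDiffOn.mul (ht.div_const 2).neg ?_)
    fun_prop
  · exact (contDiff_oscillatoryIntegral g).comp_contDiffOn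
      (ContDiffOn.prodMk (ht.div_const 2).neg (hc.smul contDiffOn_snd))

theorem hasDerivAt_mehlerIntegral_time {d : ℕ} (g : SchwartzMap (Fin d → ℝ) ℂ) {t : ℝ}
    (ht : cos t ≠ 0) (x : Fin d → ℝ) :
    HasDerivAt (fun s => mehlerIntegral g s x)
      (-(Complex.I / 2) * ((cos t)⁻¹ : ℝ) ^ 2 * ((∑ j, x j ^ 2 : ℝ) * mehlerIntegral g t x +
        ∑ j, mehlerIntegral (coordMul j (coordMul j g)) t x -
        2 * sin t * ∑ j, x j * mehlerIntegral (coordMul j g) t x)) t := by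
  have h1 : HasDerivAt (fun s => -(tan s / 2)) (-((cos t)⁻¹ ^ 2 / 2)) t := by
    exact ((hasDerivAt_tan ht).div_const 2).neg.congr_deriv (by simp)
  have h2 : HasDerivAt (fun s => (cos s)⁻¹ • x) ((sin t * (cos t)⁻¹ ^ 2) • x) t := by
    refine (((hasDerivAt_cos t).inv ht).smul_const x).congr_deriv ?_
    congr 1; field_simp
  have h3 := (((h1.mul_const (∑ j, x j ^ 2)).ofReal_comp).const_mul Complex.I).cexp
  refine (h3.mul (hasDerivAt_oscillatoryIntegral g (h1.prodMk h2))).congr_deriv ?_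
  simp only [mehlerIntegral, Pi.smul_apply, smul_eq_mul, ← Finset.mul_sum]
  push_cast
  simp only [mul_assoc, mul_left_comm _ (Complex.exp _), ← Finset.mul_sum]
  ring

theorem hasDerivAt_mehlerIntegral_update {d : ℕ} (g : SchwartzMap (Fin d → ℝ) ℂ) (t : ℝ)
    (x : Fin d → ℝ) (j : Fin d) (r : ℝ) :
    HasDerivAt (fun s => mehlerIntegral g t (Function.update x j s))
      (-(Complex.I * tan t * r) * mehlerIntegral g t (Function.update x j r) +
        Complex.I * ((cos t)⁻¹ : ℝ) * mehlerIntegral (coordMul j g) t (Function.update x j r))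
      r := by
  have h0 : HasDerivAt (Function.update x j) (Pi.single j 1) r := hasDerivAt_update x j r
  have h1 : HasDerivAt (fun s => ∑ k, Function.update x j s k ^ 2) (2 * r) r := by
    refine (HasDerivAt.fun_sum fun k _ => ((hasDerivAt_pi.1 h0 k).pow 2)).congr_deriv ?_
    simp [Pi.single_apply]
  have h2 := (hasDerivAt_const r (-(tan t / 2))).prodMk (h0.const_smul (cos t)⁻¹)
  have h3 := (((h1.const_mul (-(tan t / 2))).ofReal_comp).const_mul Complex.I).cexp
  refine (h3.mul (hasDerivAt_oscillatoryIntegral g h2)).congr_deriv ?_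
  have hs (f : Fin d → ℂ) :
      ∑ k, (((cos t)⁻¹ • (Pi.single j 1 : Fin d → ℝ)) k : ℂ) * f k = ((cos t)⁻¹ : ℝ) * f j := by
    rw [Finset.sum_eq_single j] <;> simp +contextual
  simp only [mehlerIntegral, hs]
  simp only [Pi.smul_apply]
  push_cast
  ring

theorem deriv_deriv_mehlerIntegral_update {d : ℕ} (g : SchwartzMap (Fin d → ℝ) ℂ) (A : ℂ)
    (t : ℝ) (x : Fin d → ℝ) (j : Fin d) :
    deriv (deriv fun s => A * mehlerIntegral g t (Function.update x j s)) (x j) =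
      A * (-(Complex.I * tan t * mehlerIntegral g t x) -
        (tan t : ℂ) ^ 2 * (((x j ^ 2 : ℝ) : ℂ) * mehlerIntegral g t x) +
        2 * tan t * ((cos t)⁻¹ : ℝ) * (x j * mehlerIntegral (coordMul j g) t x) -
        ((cos t)⁻¹ : ℝ) ^ 2 * mehlerIntegral (coordMul j (coordMul j g)) t x) := by
  have h1 : deriv (fun s => A * mehlerIntegral g t (Function.update x j s)) = _ :=
    funext fun r => ((hasDerivAt_mehlerIntegral_update g t x j r).const_mul A).deriv
  have hid : HasDerivAt (fun r : ℝ => -(Complex.I * tan t * (r : ℂ)))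
      (-(Complex.I * tan t * (1 : ℝ))) (x j) :=
    (((hasDerivAt_id (x j)).ofReal_comp).const_mul _).neg
  have h2 := (((hid.mul (hasDerivAt_mehlerIntegral_update g t x j (x j))).add
    ((hasDerivAt_mehlerIntegral_update (coordMul j g) t x j (x j)).const_mul
      (Complex.I * ((cos t)⁻¹ : ℝ)))).const_mul A)
  rw [h1]
  refine h2.deriv.trans ?_
  simp only [Function.update_eq_self]
  simp only [Complex.ofReal_one, Complex.ofReal_pow]
  linear_combination (A * ((tan t : ℂ) ^ 2 * x j ^ 2 * mehlerIntegral g t x -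
    2 * tan t * ((cos t)⁻¹ : ℝ) * x j * mehlerIntegral (coordMul j g) t x +
    ((cos t)⁻¹ : ℝ) ^ 2 * mehlerIntegral (coordMul j (coordMul j g)) t x)) * Complex.I_sq

theorem hasDerivAt_cos_rpow {t : ℝ} (ht : 0 < cos t) (a : ℝ) :
    HasDerivAt (fun s => cos s ^ (-a)) (a * tan t * cos t ^ (-a)) t := by
  refine ((hasDerivAt_cos t).rpow_const (.inl ht.ne')).congr_deriv ?_
  rw [rpow_sub_one ht.ne', tan_eq_sin_div_cos]
  ring

/-- Mehler's formula: for a Schwartz datum `u₀` on `ℝ^d`, the function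
`u(t,x) = (2π)^{-d} (cos t)^{-d/2} ∫ e^{iφ₂(t,x,η)} û₀(η) dη` is smooth on
`(-π/2, π/2) × ℝ^d`, equals `u₀` at `t = 0`, and solves the Schrödinger equation
`i ∂_t u = (1/2)(-Δ u + |x|² u)` for the isotropic harmonic oscillator. -/
theorem statement10 (d : ℕ) (hd : 1 ≤ d) (u₀ : SchwartzMap (Fin d → ℝ) ℂ)
    (φ₂ : ℝ → (Fin d → ℝ) → (Fin d → ℝ) → ℝ)
    (hφ₂ : ∀ (t : ℝ) (x η : Fin d → ℝ),
      φ₂ t x η = (1 / Real.cos t) * ((∑ j, x j * η j) -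
        Real.sin t * ((∑ j, (x j) ^ 2 + ∑ j, (η j) ^ 2) / 2)))
    (u₀hat : (Fin d → ℝ) → ℂ)
    (hu₀hat : ∀ η : Fin d → ℝ,
      u₀hat η = ∫ y : Fin d → ℝ, Complex.exp (-(Complex.I * (∑ j, y j * η j))) * u₀ y)
    (u : ℝ → (Fin d → ℝ) → ℂ)
    (hu : ∀ (t : ℝ) (x : Fin d → ℝ),
      u t x = (((2 * π) ^ (-(d : ℝ)) * Real.cos t ^ (-(d : ℝ) / 2) : ℝ) : ℂ) *
        ∫ η : Fin d → ℝ, Complex.exp (Complex.I * (φ₂ t x η : ℝ)) * u₀hat η) :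
    ContDiffOn ℝ (⊤ : ℕ∞) (fun p : ℝ × (Fin d → ℝ) => u p.1 p.2)
      (Set.Ioo (-(π / 2)) (π / 2) ×ˢ Set.univ) ∧
    (∀ x : Fin d → ℝ, u 0 x = u₀ x) ∧
    (∀ t ∈ Set.Ioo (-(π / 2)) (π / 2), ∀ x : Fin d → ℝ,
      Complex.I * deriv (fun s => u s x) t =
        (1 / 2) * (-(∑ j, deriv (deriv (fun s : ℝ => u t (Function.update x j s))) (x j)) +
          ((∑ j, (x j) ^ 2 : ℝ) : ℂ) * u t x)) := by
  obtain ⟨g, hg, hinv⟩ := SchwartzMap.exists_pi_fourier d u₀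
  obtain rfl : u₀hat = g := funext fun η => by rw [hu₀hat, hg]
  set A : ℝ → ℝ := fun t => (2 * π) ^ (-(d : ℝ)) * cos t ^ (-(d : ℝ) / 2) with hA
  have hu' (t : ℝ) (x : Fin d → ℝ) : u t x = A t * mehlerIntegral g t x := by
    simp only [hu, mehlerIntegral_eq, hφ₂, hA]
  have hcos {t : ℝ} (ht : t ∈ Set.Ioo (-(π / 2)) (π / 2)) : 0 < cos t := cos_pos_of_mem_Ioo ht
  refine ⟨?_, fun x => ?_, fun t ht x => ?_⟩
  · simp only [hu']
    refine ContDiffOn.mul ?_ ((contDiffOn_mehlerIntegral g).mono fun p hp => (hcos hp.1).ne')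
    refine Complex.ofRealCLM.contDiff.comp_contDiffOn (contDiffOn_const.mul ?_)
    exact ContDiffOn.rpow_const_of_ne (by fun_prop) fun p hp => (hcos hp.1).ne'
  · rw [← hinv x, hu]
    simp [hφ₂, rpow_neg two_pi_pos.le]
  · have hc := (hcos ht).ne'
    have hAd : HasDerivAt A (d / 2 * tan t * A t) t := by
      have := (hasDerivAt_cos_rpow (hcos ht) (d / 2)).const_mul ((2 * π) ^ (-(d : ℝ)))
      simp only [← neg_div] at this
      exact this.congr_deriv (by simp only [hA]; ring)
    have h1 := (hAd.ofReal_comp.mul (hasDerivAt_mehlerIntegral_time g hc x)).deriv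
    have hsec : (((cos t)⁻¹ : ℝ) : ℂ) ^ 2 = (tan t : ℂ) ^ 2 + 1 := by
      norm_cast
      rw [tan_eq_sin_div_cos]
      field_simp
      rw [sin_sq_add_cos_sq]
    have htan : (tan t : ℂ) = sin t * ((cos t)⁻¹ : ℝ) := by
      rw [← Complex.ofReal_mul, tan_eq_sin_div_cos, div_eq_mul_inv]
    simp only [hu', deriv_deriv_mehlerIntegral_update]
    refine (congrArg (Complex.I * ·) h1).trans ?_
    simp only [← Finset.mul_sum, Finset.sum_add_distrib, Finset.sum_sub_distrib,
      Finset.sum_neg_distrib, ← Finset.sum_mul, ← Complex.ofReal_sum]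
    simp only [Finset.sum_const, Finset.card_univ, Fintype.card_fin, nsmul_eq_mul,
      Complex.ofReal_mul, Complex.ofReal_div, Complex.ofReal_natCast, Complex.ofReal_ofNat]
    generalize ((cos t)⁻¹ : ℝ) = c at *
    generalize ((∑ j, x j ^ 2 : ℝ) : ℂ) = X
    generalize mehlerIntegral g t x = U
    generalize (tan t : ℂ) = τ at *
    generalize ∑ j, (x j : ℂ) * mehlerIntegral (coordMul j g) t x = U₁
    generalize ∑ j, mehlerIntegral (coordMul j (coordMul j g)) t x = U₂
    linear_combination (-(A t : ℂ) / 2 * c ^ 2 * (X * U + U₂ - 2 * sin t * U₁)) * Complex.I_sq +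
      (A t : ℂ) / 2 * X * U * hsec + (A t : ℂ) * c * U₁ * htan
end

section
/- Weak stationary phase with measure-zero infinitely degenerate set: let n ≥ 1, let g : ℝ^n → ℝ be smooth, and let K ⊂ ℝ^n be compact. Assume the set Z = {x ∈ K : ∂^α g(x) = 0 for every multiindex α with |α| ≥ 1} has Lebesgue measure zero. Let (b_λ)_{λ ≥ 1} be a family of smooth functions ℝ^n → ℂ, each supported in K, such that for every k ∈ ℕ one has sup_{λ ≥ 1} sup_{x ∈ ℝ^n} ‖iteratedFDeriv^k b_λ(x)‖ < ∞. Then ∫_{ℝ^n} e^{iλ·g(x)} b_λ(x) dx → 0 as λ → ∞. -/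
open MeasureTheory Filter Topology

/-- A curve can vanish with nonzero velocity only at countably many times. -/
lemma countable_zeros_of_deriv_ne_zero {F : Type*} [NormedAddCommGroup F] [NormedSpace ℝ F]
    {f f' : ℝ → F} (hf : ∀ t, HasDerivAt f (f' t) t) :
    {t | f t = 0 ∧ f' t ≠ 0}.Countable := by
  have : DiscreteTopology {t | f t = 0 ∧ f' t ≠ 0} := by
    refine discreteTopology_of_noAccPts fun t ht hacc => ?_
    rw [accPt_iff_frequently_nhdsNE] at hacc
    refine hacc (((hf t).eventually_ne (c := 0) ht.2).mono fun s hs h => hs h.1)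
  exact countable_of_Lindelof_of_discrete

lemma differentiableAt_and_fderiv_exp_I_mul {E : Type*} [NormedAddCommGroup E] [NormedSpace ℝ E] {g : E → ℝ}
    (hg : Differentiable ℝ g) (lam : ℝ) (x v : E) :
    DifferentiableAt ℝ (fun x => Complex.exp (Complex.I * lam * g x)) x ∧
    fderiv ℝ (fun x => Complex.exp (Complex.I * lam * g x)) x v =
      Complex.I * lam * (Complex.exp (Complex.I * lam * g x) * (fderiv ℝ g x v : ℝ)) := by
  have h1 : HasFDerivAt (fun x => (g x : ℂ)) (Complex.ofRealCLM.comp (fderiv ℝ g x)) x :=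
    Complex.ofRealCLM.hasFDerivAt.comp x (hg x).hasFDerivAt
  have h2 := (h1.const_mul (Complex.I * lam)).cexp
  refine ⟨h2.differentiableAt, ?_⟩
  rw [h2.fderiv]
  simp
  ring

lemma norm_exp_I_mul (a t : ℝ) : ‖Complex.exp (Complex.I * a * t)‖ = 1 := by
  rw [show Complex.I * a * t = ((a * t : ℝ) : ℂ) * Complex.I by push_cast; ring]
  exact Complex.norm_exp_ofReal_mul_I _

section

variable {E : Type*} [NormedAddCommGroup E] [NormedSpace ℝ E] [FiniteDimensional ℝ E]
  [MeasurableSpace E] [BorelSpace E] (μ : Measure E) [μ.IsAddHaarMeasure]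

/-- At almost every zero of a `C¹` function, the derivative vanishes as well. -/
lemma ae_fderiv_eq_zero_of_eq_zero {F : Type*} [NormedAddCommGroup F] [NormedSpace ℝ F]
    {f : E → F} (hf : ContDiff ℝ 1 f) : ∀ᵐ x ∂μ, f x = 0 → fderiv ℝ f x = 0 := by
  have hc : Continuous (fderiv ℝ f) := hf.continuous_fderiv one_ne_zero
  have key : ∀ v : E, ∀ᵐ x ∂μ, x ∈ {x | f x = 0 ∧ fderiv ℝ f x v ≠ 0}ᶜ := by
    intro v
    refine ae_mem_of_ae_add_linearMap_mem (LinearMap.toSpanSingleton ℝ E v) volume μ ?_ fun y => ?_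
    · exact ((isClosed_eq hf.continuous continuous_const).measurableSet.inter
        (isClosed_eq (hc.clm_apply continuous_const) continuous_const).measurableSet.compl).compl
    · have hd : ∀ t : ℝ, HasDerivAt (fun s : ℝ => f (y + s • v)) (fderiv ℝ f (y + t • v) v) t := by
        intro t
        have h1 : HasDerivAt (fun s : ℝ => y + s • v) v t := by
          simpa using ((hasDerivAt_id t).smul_const v).const_add y
        exact ((hf.differentiable one_ne_zero).differentiableAt.hasFDerivAt
          (x := y + t • v)).comp_hasDerivAt t h1
      have := (countable_zeros_of_deriv_ne_zero hd).ae_notMem volume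
      simpa [LinearMap.toSpanSingleton_apply] using this
  let e := Module.finBasis ℝ E
  filter_upwards [ae_all_iff.2 fun i => key (e i)] with x hx h0
  refine ContinuousLinearMap.coe_injective (e.ext fun i => ?_)
  by_contra hne
  exact hx i ⟨h0, hne⟩

/-- At almost every critical point of a smooth function, all derivatives vanish. -/
lemma ae_iteratedFDeriv_eq_zero_of_fderiv_eq_zero {F : Type*} [NormedAddCommGroup F]
    [NormedSpace ℝ F] {f : E → F} (hf : ContDiff ℝ (⊤ : ℕ∞) f) :
    ∀ᵐ x ∂μ, fderiv ℝ f x = 0 → ∀ k : ℕ, 1 ≤ k → iteratedFDeriv ℝ k f x = 0 := by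
  have hk : ∀ k : ℕ, ContDiff ℝ 1 (iteratedFDeriv ℝ k f) := fun k =>
    hf.iteratedFDeriv_right (by exact_mod_cast le_top)
  filter_upwards [ae_all_iff.2 fun k => ae_fderiv_eq_zero_of_eq_zero μ (hk k)] with x hx h0 k h1
  induction k, h1 using Nat.le_induction with
  | base => rw [← norm_eq_zero, norm_iteratedFDeriv_one, h0, norm_zero]
  | succ k _ ih =>
    rw [iteratedFDeriv_succ_eq_comp_left, Function.comp_apply, hx k ih]
    exact LinearIsometryEquiv.map_zero _

/-- One integration by parts gains a factor `lam⁻¹` when a derivative of the phase can be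
factored out of the amplitude. -/
lemma abs_mul_norm_integral_exp_le {g : E → ℝ} (hg : ContDiff ℝ 1 g) {φ : E → ℂ}
    (hφ : ContDiff ℝ 1 φ) (hs : HasCompactSupport φ) (v : E) (lam : ℝ) :
    |lam| * ‖∫ x, Complex.exp (Complex.I * lam * g x) * ((fderiv ℝ g x v : ℝ) * φ x) ∂μ‖ ≤
      ∫ x, ‖fderiv ℝ φ x v‖ ∂μ := by
  have hgd : Differentiable ℝ g := hg.differentiable one_ne_zero
  have hgc : Continuous g := hg.continuous
  have hg' : Continuous fun x => fderiv ℝ g x v :=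
    (hg.continuous_fderiv one_ne_zero).clm_apply continuous_const
  have hφ' : Continuous fun x => fderiv ℝ φ x v :=
    (hφ.continuous_fderiv one_ne_zero).clm_apply continuous_const
  have hφc : Continuous φ := hφ.continuous
  have hs' : HasCompactSupport fun x => fderiv ℝ φ x v := hs.fderiv_apply (𝕜 := ℝ) v
  have he : Continuous fun x => Complex.exp (Complex.I * lam * g x) := by fun_prop
  have hfd : ∀ x, fderiv ℝ (fun x => Complex.exp (Complex.I * lam * g x)) x v = _ :=
    fun x => (differentiableAt_and_fderiv_exp_I_mul hgd lam x v).2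
  have ibp := integral_mul_fderiv_eq_neg_fderiv_mul_of_integrable (μ := μ) (v := v)
    (f := fun x => Complex.exp (Complex.I * lam * g x)) (g := φ)
    (by
      simp only [hfd]
      exact Continuous.integrable_of_hasCompactSupport (by fun_prop) hs.mul_left)
    ((he.mul hφ').integrable_of_hasCompactSupport hs'.mul_left)
    ((he.mul hφc).integrable_of_hasCompactSupport hs.mul_left)
    (fun x _ => (differentiableAt_and_fderiv_exp_I_mul hgd lam x v).1)
    (fun x _ => hφ.differentiable one_ne_zero x)
  simp only [hfd] at ibp
  simp only [mul_assoc (Complex.I * (lam : ℂ)), integral_const_mul] at ibp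
  have h := congrArg norm ibp
  rw [norm_neg, norm_mul, norm_mul, Complex.norm_I, one_mul, Complex.norm_real,
    Real.norm_eq_abs] at h
  simp only [mul_assoc] at h ⊢
  rw [← h]
  refine (norm_integral_le_integral_norm _).trans (le_of_eq ?_)
  congr 1 with x
  rw [norm_mul, ← mul_assoc, norm_exp_I_mul, one_mul]

/-- Oscillatory integrals whose amplitudes contain a derivative of the phase as a factor decay,
provided that the amplitudes are `C¹`-bounded with supports in a fixed compact set. -/
lemma tendsto_integral_exp_mul_fderiv {g : E → ℝ} (hg : ContDiff ℝ 1 g) {K : Set E}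
    (hK : IsCompact K) {b : ℝ → E → ℂ} (hb : ∀ lam, 1 ≤ lam → ContDiff ℝ 1 (b lam))
    (hbK : ∀ lam, 1 ≤ lam → Function.support (b lam) ⊆ K) {C₀ C₁ : ℝ}
    (h₀ : ∀ lam, 1 ≤ lam → ∀ x, ‖b lam x‖ ≤ C₀)
    (h₁ : ∀ lam, 1 ≤ lam → ∀ x, ‖fderiv ℝ (b lam) x‖ ≤ C₁)
    {G : E → ℝ} (hG : ContDiff ℝ 1 G) (v : E) :
    Tendsto (fun lam : ℝ => ∫ x, Complex.exp (Complex.I * lam * g x) *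
      ((fderiv ℝ g x v : ℝ) * (G x • b lam x)) ∂μ) atTop (𝓝 0) := by
  obtain ⟨A, hA⟩ := hK.exists_bound_of_continuousOn hG.continuous.continuousOn
  obtain ⟨A', hA'⟩ := hK.exists_bound_of_continuousOn
    ((hG.continuous_fderiv one_ne_zero).clm_apply (continuous_const (y := v))).continuousOn
  set M := A * (C₁ * ‖v‖) + A' * C₀
  have key : ∀ lam : ℝ, 1 ≤ lam →
      ∫ x, ‖fderiv ℝ (fun x => G x • b lam x) x v‖ ∂μ ≤ M * μ.real K := by
    intro lam hl
    have hsub : Function.support (fun x => G x • b lam x) ⊆ K :=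
      (Function.support_smul_subset_right G (b lam)).trans (hbK lam hl)
    have hz : ∀ x, x ∉ K → ‖fderiv ℝ (fun x => G x • b lam x) x v‖ = 0 := by
      intro x hx
      have : x ∉ tsupport (fun x => G x • b lam x) := fun h =>
        hx (closure_minimal hsub hK.isClosed h)
      rw [fderiv_of_notMem_tsupport ℝ this]
      simp
    rw [← setIntegral_eq_integral_of_forall_compl_eq_zero hz]
    refine (le_abs_self _).trans ?_
    rw [← Real.norm_eq_abs]
    refine norm_setIntegral_le_of_norm_le_const hK.measure_lt_top fun x hx => ?_
    rw [norm_norm, fderiv_fun_smul (hG.differentiable one_ne_zero x)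
      ((hb lam hl).differentiable one_ne_zero x)]
    simp only [add_apply, smul_apply,
      ContinuousLinearMap.smulRight_apply]
    refine (norm_add_le _ _).trans ?_
    rw [norm_smul, norm_smul]
    have hC₀ := h₀ lam hl x
    have hb1 : ‖fderiv ℝ (b lam) x v‖ ≤ C₁ * ‖v‖ :=
      ((fderiv ℝ (b lam) x).le_opNorm v).trans (by gcongr; exact h₁ lam hl x)
    have a1 := hA x hx
    have a2 := hA' x hx
    have a3 := (norm_nonneg _).trans a1
    have a4 := (norm_nonneg _).trans a2
    exact add_le_add (mul_le_mul a1 hb1 (norm_nonneg _) a3)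
      (mul_le_mul a2 hC₀ (norm_nonneg _) a4)
  refine squeeze_zero_norm' (a := fun lam : ℝ => M * μ.real K / lam) ?_
    (tendsto_const_nhds.div_atTop tendsto_id)
  filter_upwards [eventually_ge_atTop 1] with lam hl
  have hpos : 0 < lam := by linarith
  rw [le_div_iff₀ hpos, mul_comm]
  have hcs : HasCompactSupport (b lam) :=
    HasCompactSupport.of_support_subset_isCompact hK (hbK lam hl)
  have := abs_mul_norm_integral_exp_le μ hg (hG.smul (hb lam hl)) hcs.smul_left v lam
  rw [abs_of_pos hpos] at this
  exact this.trans (key lam hl)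

/-- Weak stationary phase, when almost every point of the compact set `K` is noncritical. -/
lemma tendsto_integral_exp_of_ae_fderiv_ne_zero {g : E → ℝ} (hg : ContDiff ℝ 2 g) {K : Set E}
    (hK : IsCompact K) (hcrit : ∀ᵐ x ∂μ, x ∈ K → fderiv ℝ g x ≠ 0)
    {b : ℝ → E → ℂ} (hb : ∀ lam, 1 ≤ lam → ContDiff ℝ 1 (b lam))
    (hbK : ∀ lam, 1 ≤ lam → Function.support (b lam) ⊆ K) {C₀ C₁ : ℝ}
    (h₀ : ∀ lam, 1 ≤ lam → ∀ x, ‖b lam x‖ ≤ C₀)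
    (h₁ : ∀ lam, 1 ≤ lam → ∀ x, ‖fderiv ℝ (b lam) x‖ ≤ C₁) :
    Tendsto (fun lam : ℝ => ∫ x, Complex.exp (Complex.I * lam * g x) * b lam x ∂μ)
      atTop (𝓝 0) := by
  let e := Module.finBasis ℝ E
  have hg1 : ContDiff ℝ 1 g := hg.of_le one_le_two
  have hgi : ∀ i, ContDiff ℝ 1 fun x => fderiv ℝ g x (e i) := fun i =>
    (hg.fderiv_right (m := 1) (by norm_num [one_add_one_eq_two])).clm_apply contDiff_const
  let h : E → ℝ := fun x => ∑ i, fderiv ℝ g x (e i) ^ 2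
  have hh : ContDiff ℝ 1 h := ContDiff.sum fun i _ => (hgi i).pow 2
  have hhc : Continuous h := hh.continuous
  have hh0 : ∀ x, 0 ≤ h x := fun x => Finset.sum_nonneg fun i _ => sq_nonneg _
  have hpos : ∀ᵐ x ∂μ, x ∈ K → 0 < h x := by
    filter_upwards [hcrit] with x hx hxK
    refine (hh0 x).lt_of_ne' fun h0 => hx hxK (ContinuousLinearMap.coe_injective (e.ext fun i => ?_))
    have := (Finset.sum_eq_zero_iff_of_nonneg fun i _ => sq_nonneg _).1 h0 i (Finset.mem_univ i)
    simpa using this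
  have hC₀ : 0 ≤ C₀ := (norm_nonneg _).trans (h₀ 1 le_rfl 0)
  -- the regularisation error is small, uniformly in `lam`
  have herr : Tendsto (fun δ : ℝ => ∫ x in K, δ / (h x + δ) ∂μ) (𝓝[>] 0) (𝓝 0) := by
    have := tendsto_integral_filter_of_dominated_convergence (μ := μ.restrict K)
      (F := fun (δ : ℝ) x => δ / (h x + δ)) (f := fun _ => 0) (l := 𝓝[>] (0 : ℝ)) (fun _ => 1)
      (by
        filter_upwards [self_mem_nhdsWithin] with δ hδ
        refine Continuous.aestronglyMeasurable (continuous_const.div (by fun_prop) fun x => ?_)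
        have := hh0 x
        have : 0 < δ := hδ
        positivity)
      (by
        filter_upwards [self_mem_nhdsWithin] with δ hδ
        have hδ : 0 < δ := hδ
        refine Eventually.of_forall fun x => ?_
        have := hh0 x
        rw [Real.norm_of_nonneg (by positivity), div_le_one (by positivity)]
        linarith)
      (integrable_const_iff.2 (.inr ⟨by simpa using hK.measure_lt_top⟩))
      (by
        refine (ae_restrict_iff' hK.measurableSet).2 ?_
        filter_upwards [hpos] with x hx hxK
        have hx := hx hxK
        have : Tendsto (fun δ : ℝ => δ / (h x + δ)) (𝓝 0) (𝓝 (0 / (h x + 0))) :=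
          tendsto_id.div (tendsto_const_nhds.add tendsto_id) (by simpa using hx.ne')
        rw [zero_div] at this
        exact this.mono_left nhdsWithin_le_nhds)
    simpa using this
  rw [Metric.tendsto_nhds]
  intro ε hε
  obtain ⟨δ, hδε, hδ⟩ : ∃ δ : ℝ, C₀ * ∫ x in K, δ / (h x + δ) ∂μ < ε / 2 ∧ 0 < δ := by
    have h2 := herr.const_mul C₀
    rw [mul_zero] at h2
    exact ((h2.eventually_lt_const (half_pos hε)).and self_mem_nhdsWithin).exists
  have hden : ∀ x, 0 < h x + δ := fun x => by have := hh0 x; positivity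
  have hG : ∀ i, ContDiff ℝ 1 fun x => fderiv ℝ g x (e i) / (h x + δ) := fun i =>
    (hgi i).div (hh.add contDiff_const) fun x => (hden x).ne'
  have hmain := tendsto_finsetSum Finset.univ fun i _ =>
    tendsto_integral_exp_mul_fderiv μ hg1 hK hb hbK h₀ h₁ (hG i) (e i)
  rw [Finset.sum_const_zero, Metric.tendsto_nhds] at hmain
  filter_upwards [hmain (ε / 2) (half_pos hε), eventually_ge_atTop 1] with lam hlam hl
  have hcs : HasCompactSupport (b lam) :=
    HasCompactSupport.of_support_subset_isCompact hK (hbK lam hl)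
  have hbc : Continuous (b lam) := (hb lam hl).continuous
  have hgc : Continuous g := hg.continuous
  have hint : ∀ c : E → ℂ, Continuous c → Integrable (fun x => c x * b lam x) μ := fun c hc =>
    (hc.mul hbc).integrable_of_hasCompactSupport hcs.mul_left
  have hic : ∀ i, Integrable (fun x => Complex.exp (Complex.I * lam * g x) *
      ((fderiv ℝ g x (e i) : ℝ) * ((fderiv ℝ g x (e i) / (h x + δ)) • b lam x))) μ := fun i => by
    have := (hG i).continuous
    have := (hgi i).continuous
    refine (hint (fun x => Complex.exp (Complex.I * lam * g x) *
      ((fderiv ℝ g x (e i) : ℝ) * (fderiv ℝ g x (e i) / (h x + δ) : ℝ))) (by fun_prop)).congr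
      (Eventually.of_forall fun x => ?_)
    simp only [Complex.real_smul, mul_assoc]
  have hirem : Integrable (fun x => Complex.exp (Complex.I * lam * g x) *
      ((δ / (h x + δ)) • b lam x)) μ := by
    have : Continuous fun x => δ / (h x + δ) :=
      continuous_const.div (by fun_prop) fun x => (hden x).ne'
    refine (hint (fun x => Complex.exp (Complex.I * lam * g x) * (δ / (h x + δ) : ℝ))
      (by fun_prop)).congr (Eventually.of_forall fun x => ?_)
    simp only [Complex.real_smul, mul_assoc]
  have hsplit : ∫ x, Complex.exp (Complex.I * lam * g x) * b lam x ∂μ =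
      (∑ i, ∫ x, Complex.exp (Complex.I * lam * g x) *
        ((fderiv ℝ g x (e i) : ℝ) * ((fderiv ℝ g x (e i) / (h x + δ)) • b lam x)) ∂μ) +
      ∫ x, Complex.exp (Complex.I * lam * g x) * ((δ / (h x + δ)) • b lam x) ∂μ := by
    rw [← integral_finsetSum _ fun i _ => hic i,
      ← integral_add (integrable_finsetSum _ fun i _ => hic i) hirem]
    congr 1 with x
    rw [← Finset.mul_sum, ← mul_add]
    congr 1
    have : ∀ i, ((fderiv ℝ g x (e i) : ℝ) : ℂ) * ((fderiv ℝ g x (e i) / (h x + δ)) • b lam x) =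
        (fderiv ℝ g x (e i) ^ 2 / (h x + δ)) • b lam x := fun i => by
      simp only [Complex.real_smul]
      push_cast
      ring
    simp only [this]
    rw [← Finset.sum_smul, ← Finset.sum_div, ← add_smul, ← add_div, div_self (hden x).ne', one_smul]
  have hrem : ‖∫ x, Complex.exp (Complex.I * lam * g x) * ((δ / (h x + δ)) • b lam x) ∂μ‖ ≤
      C₀ * ∫ x in K, δ / (h x + δ) ∂μ := by
    rw [← setIntegral_eq_integral_of_forall_compl_eq_zero (s := K) fun x hx => by
      rw [Function.notMem_support.1 fun h => hx (hbK lam hl h), smul_zero, mul_zero],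
      ← integral_const_mul]
    have hcont : Continuous fun x => δ / (h x + δ) :=
      continuous_const.div (by fun_prop) fun x => (hden x).ne'
    refine norm_integral_le_of_norm_le
      ((hcont.continuousOn.integrableOn_compact hK).const_mul C₀) (Eventually.of_forall fun x => ?_)
    have := hden x
    rw [norm_mul, norm_exp_I_mul, one_mul, norm_smul, Real.norm_of_nonneg (by positivity), mul_comm]
    gcongr
    exact h₀ lam hl x
  rw [hsplit, dist_zero_right]
  rw [dist_zero_right] at hlam
  exact (norm_add_le _ _).trans_lt (by linarith)

end

/-- Weak stationary phase with a measure-zero infinitely degenerate set: if the set of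
points of the compact support `K` where all derivatives of the smooth real phase `g`
vanish has measure zero, and `(b_λ)` is a family of smooth amplitudes supported in `K`
with uniformly bounded derivatives of all orders, then
`∫ e^{iλg} b_λ → 0` as `λ → ∞`. -/
theorem statement12 (n : ℕ) (hn : 1 ≤ n)
    (g : (Fin n → ℝ) → ℝ) (hg : ContDiff ℝ (⊤ : ℕ∞) g)
    (K : Set (Fin n → ℝ)) (hK : IsCompact K)
    (hZ : volume {x ∈ K | ∀ k : ℕ, 1 ≤ k → iteratedFDeriv ℝ k g x = 0} = 0)
    (b : ℝ → (Fin n → ℝ) → ℂ)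
    (hb_smooth : ∀ lam : ℝ, 1 ≤ lam → ContDiff ℝ (⊤ : ℕ∞) (b lam))
    (hb_supp : ∀ lam : ℝ, 1 ≤ lam → Function.support (b lam) ⊆ K)
    (hb_bdd : ∀ k : ℕ, ∃ C : ℝ, ∀ lam : ℝ, 1 ≤ lam → ∀ x : Fin n → ℝ,
      ‖iteratedFDeriv ℝ k (b lam) x‖ ≤ C) :
    Tendsto (fun lam : ℝ => ∫ x : Fin n → ℝ, Complex.exp (Complex.I * lam * g x) * b lam x)
      atTop (nhds 0) := by
  obtain ⟨C₀, h₀⟩ := hb_bdd 0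
  obtain ⟨C₁, h₁⟩ := hb_bdd 1
  simp only [norm_iteratedFDeriv_zero] at h₀
  simp only [norm_iteratedFDeriv_one] at h₁
  refine tendsto_integral_exp_of_ae_fderiv_ne_zero volume (contDiff_infty.1 hg 2) hK ?_
    (fun lam hl => (hb_smooth lam hl).of_le (by exact_mod_cast le_top)) hb_supp h₀ h₁
  filter_upwards [ae_iteratedFDeriv_eq_zero_of_fderiv_eq_zero volume hg,
    measure_eq_zero_iff_ae_notMem.1 hZ] with x hx hxZ hxK h0
  exact hxZ ⟨hxK, hx h0⟩
end

section
/- Fix d ≥ 1, let w be a tempered distribution on ℝ^d (a continuous linear functional on the Schwartz space 𝓢(ℝ^d; ℂ)), and let b : ℝ^d × ℝ^d → ℂ be smooth and compactly supported. For each x ∈ ℝ^d the function ξ ↦ e^{i⟨x,ξ⟩}·b(x, ξ) is a Schwartz function on ℝ^d, and the map F : ℝ^d → ℂ defined by F(x) = w(ξ ↦ e^{i⟨x,ξ⟩}·b(x, ξ)) is smooth on ℝ^d. -/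
open scoped RealInnerProductSpace

namespace SchwartzMap

open scoped SchwartzMap LineDeriv ContDiff Topology

section TranslationRemainder

variable {E F : Type*} [NormedAddCommGroup E] [NormedSpace ℝ E]
  [NormedAddCommGroup F] [NormedSpace ℝ F]

theorem lineDerivOp_compSubConstCLM (f : 𝓢(E, F)) (v y : E) :
    ∂_{v} (f.compSubConstCLM ℝ y) = (∂_{v} f).compSubConstCLM ℝ y := by
  ext x
  exact congrArg (· v) (fderiv_comp_sub (𝕜 := ℝ) (f := f) (x := x) y)

/-- The remainder in the first-order Taylor expansion of the translate `f (· + h)`. -/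
noncomputable def translationRemainder (h : E) (f : 𝓢(E, F)) : 𝓢(E, F) :=
  f.compSubConstCLM ℝ (-h) - f - ∂_{h} f

theorem translationRemainder_apply (h : E) (f : 𝓢(E, F)) (x : E) :
    translationRemainder h f x = f (x + h) - f x - fderiv ℝ f x h := by
  simp [translationRemainder, lineDerivOp_apply_eq_fderiv]

theorem fderiv_translationRemainder (h : E) (f : 𝓢(E, F)) :
    fderiv ℝ (translationRemainder h f) = translationRemainder h (fderivCLM ℝ E F f) := by
  ext x v
  have hsymm : fderiv ℝ (fderiv ℝ f) x v h = fderiv ℝ (fderiv ℝ f) x h v :=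
    ((f.smooth 2).contDiffAt.isSymmSndFDerivAt (by simp)) v h
  have h1 : HasFDerivAt (fun y => f (y + h)) (fderiv ℝ f (x + h)) x :=
    (hasFDerivAt_comp_add_right h).2 (f.hasFDerivAt (x + h))
  have h2 : HasFDerivAt (fun y => fderiv ℝ f y h)
      ((fderiv ℝ (fderiv ℝ f) x).flip h) x :=
    ((fderivCLM ℝ E F f).hasFDerivAt x).clm_apply (hasFDerivAt_const h x) |>.congr_fderiv (by
      ext; simp; rfl)
  have h3 : HasFDerivAt (translationRemainder h f)
      (fderiv ℝ f (x + h) - fderiv ℝ f x - (fderiv ℝ (fderiv ℝ f) x).flip h) x :=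
    ((h1.sub (f.hasFDerivAt x)).sub h2).congr_of_eventuallyEq
      (.of_forall (translationRemainder_apply h f))
  rw [h3.fderiv, translationRemainder_apply]
  change _ = (fderiv ℝ f (x + h) - fderiv ℝ f x - fderiv ℝ (fderiv ℝ f) x h) v
  simp [hsymm]

theorem exists_pow_mul_norm_translationRemainder_le (f : 𝓢(E, F)) (k : ℕ) :
    ∃ C, 0 ≤ C ∧ ∀ h : E, ‖h‖ ≤ 1 → ∀ x,
      ‖x‖ ^ k * ‖translationRemainder h f x‖ ≤ C * ‖h‖ ^ 2 := by
  set M : ℝ := 2 ^ k * (Finset.Iic (k, 2)).sup (schwartzSeminormFamily ℝ E F) f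
  have hbound : ∀ z, (1 + ‖z‖) ^ k * ‖iteratedFDeriv ℝ 2 f z‖ ≤ M := fun z =>
    one_add_le_sup_seminorm_apply (m := (k, 2)) le_rfl le_rfl f z
  refine ⟨M, by positivity, fun h hh x => ?_⟩
  have hnear : ∀ z ∈ Metric.closedBall x ‖h‖,
      ‖fderiv ℝ (fderiv ℝ f) z‖ * ‖x‖ ^ k ≤ M := by
    intro z hz
    have h1 : ‖x‖ ≤ 1 + ‖z‖ := by
      have h2 := norm_sub_norm_le x z
      rw [Metric.mem_closedBall, dist_comm, dist_eq_norm] at hz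
      linarith
    have h3 : ‖fderiv ℝ (fderiv ℝ f) z‖ = ‖iteratedFDeriv ℝ 2 f z‖ := by
      rw [← norm_iteratedFDeriv_fderiv, ← norm_iteratedFDeriv_fderiv, norm_iteratedFDeriv_zero]
    calc _ ≤ ‖iteratedFDeriv ℝ 2 f z‖ * (1 + ‖z‖) ^ k := by rw [h3]; gcongr
      _ ≤ M := by rw [mul_comm]; exact hbound z
  rcases eq_or_ne (‖x‖ ^ k) 0 with h0 | h0
  · rw [h0, zero_mul]; positivity
  have hpos : 0 < ‖x‖ ^ k := lt_of_le_of_ne (by positivity) h0.symm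
  have hx : x ∈ Metric.closedBall x ‖h‖ := Metric.mem_closedBall_self (norm_nonneg _)
  have hconv : Convex ℝ (Metric.closedBall x ‖h‖) := convex_closedBall _ _
  have hlip : ∀ z ∈ Metric.closedBall x ‖h‖,
      ‖fderiv ℝ f z - fderiv ℝ f x‖ ≤ M / ‖x‖ ^ k * ‖h‖ := by
    intro z hz
    have h1 := hconv.norm_image_sub_le_of_norm_hasFDerivWithin_le (𝕜 := ℝ)
      (C := M / ‖x‖ ^ k)
      (fun y _ => ((fderivCLM ℝ E F f).hasFDerivAt y).hasFDerivWithinAt)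
      (fun y hy => (le_div_iff₀ hpos).2 (hnear y hy)) hx hz
    refine h1.trans ?_
    rw [Metric.mem_closedBall, dist_eq_norm] at hz
    gcongr
  have hxh : x + h ∈ Metric.closedBall x ‖h‖ := by simp
  have h2 := hconv.norm_image_sub_le_of_norm_hasFDerivWithin_le'
    (fun y _ => (f.hasFDerivAt y).hasFDerivWithinAt) hlip hx hxh
  rw [add_sub_cancel_left, ← translationRemainder_apply] at h2
  calc _ ≤ ‖x‖ ^ k * (M / ‖x‖ ^ k * ‖h‖ * ‖h‖) := by gcongr
    _ = M * ‖h‖ ^ 2 := by field_simp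

end TranslationRemainder

universe u

theorem exists_seminorm_translationRemainder_le {E F : Type u} [NormedAddCommGroup E]
    [NormedSpace ℝ E] [NormedAddCommGroup F] [NormedSpace ℝ F] (k n : ℕ) (f : 𝓢(E, F)) :
    ∃ C, 0 ≤ C ∧ ∀ h : E, ‖h‖ ≤ 1 →
      SchwartzMap.seminorm ℝ k n (translationRemainder h f) ≤ C * ‖h‖ ^ 2 := by
  suffices H : ∃ C, 0 ≤ C ∧ ∀ h : E, ‖h‖ ≤ 1 → ∀ x,
      ‖x‖ ^ k * ‖iteratedFDeriv ℝ n (translationRemainder h f) x‖ ≤ C * ‖h‖ ^ 2 by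
    obtain ⟨C, hC, H⟩ := H
    exact ⟨C, hC, fun h hh => seminorm_le_bound ℝ k n _ (by positivity) (H h hh)⟩
  induction n generalizing F with
  | zero => simpa using exists_pow_mul_norm_translationRemainder_le f k
  | succ n ih =>
    simpa only [← norm_iteratedFDeriv_fderiv, fderiv_translationRemainder]
      using ih (fderivCLM ℝ E F f)

theorem exists_norm_map_translationRemainder_le {E F : Type u} {G : Type*}
    [NormedAddCommGroup E] [NormedSpace ℝ E] [NormedAddCommGroup F] [NormedSpace ℝ F]
    [NormedAddCommGroup G] [NormedSpace ℝ G] (W : 𝓢(E, F) →L[ℝ] G) (f : 𝓢(E, F)) :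
    ∃ C, 0 ≤ C ∧ ∀ h : E, ‖h‖ ≤ 1 → ‖W (translationRemainder h f)‖ ≤ C * ‖h‖ ^ 2 := by
  obtain ⟨s, K, -, hK⟩ := Seminorm.bound_of_continuous (schwartz_withSeminorms ℝ E F)
    ((normSeminorm ℝ G).comp W.toLinearMap) (continuous_norm.comp W.continuous)
  choose C hC0 hC using fun i : ℕ × ℕ => exists_seminorm_translationRemainder_le i.1 i.2 f
  refine ⟨K * ∑ i ∈ s, C i, mul_nonneg K.2 (Finset.sum_nonneg fun i _ => hC0 i), fun h hh => ?_⟩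
  have hsup : s.sup (schwartzSeminormFamily ℝ E F) (translationRemainder h f) ≤
      (∑ i ∈ s, C i) * ‖h‖ ^ 2 := by
    refine Seminorm.finset_sup_apply_le
      (mul_nonneg (Finset.sum_nonneg fun i _ => hC0 i) (by positivity)) fun i hi => ?_
    refine (hC i h hh).trans ?_
    gcongr
    exact Finset.single_le_sum (fun j _ => hC0 j) hi
  calc ‖W (translationRemainder h f)‖
      ≤ K * s.sup (schwartzSeminormFamily ℝ E F) (translationRemainder h f) := hK _
    _ ≤ K * ((∑ i ∈ s, C i) * ‖h‖ ^ 2) := by gcongr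
    _ = _ := by ring

section Translate

variable {E F : Type u} {G : Type*} [NormedAddCommGroup E] [NormedSpace ℝ E]
  [FiniteDimensional ℝ E] [NormedAddCommGroup F] [NormedSpace ℝ F]
  [NormedAddCommGroup G] [NormedSpace ℝ G]

/-- The derivative at the origin of a continuous linear map applied to the translates of `f`. -/
noncomputable def translateFDeriv (W : 𝓢(E, F) →L[ℝ] G) (f : 𝓢(E, F)) : E →L[ℝ] G :=
  LinearMap.toContinuousLinearMap
    { toFun := fun v => W (∂_{v} f)
      map_add' := fun v v' => by rw [LineDeriv.lineDerivOp_left_add, map_add]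
      map_smul' := fun c v => by rw [LineDeriv.lineDerivOp_left_smul, map_smul]; rfl }

theorem translateFDeriv_apply (W : 𝓢(E, F) →L[ℝ] G) (f : 𝓢(E, F)) (v : E) :
    translateFDeriv W f v = W (∂_{v} f) := rfl

theorem hasFDerivAt_map_translate (W : 𝓢(E, F) →L[ℝ] G) (f : 𝓢(E, F)) (y : E) :
    HasFDerivAt (fun y => W (f.compSubConstCLM ℝ (-y)))
      (translateFDeriv W (f.compSubConstCLM ℝ (-y))) y := by
  obtain ⟨C, hC0, hC⟩ := exists_norm_map_translationRemainder_le W (f.compSubConstCLM ℝ (-y))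
  rw [hasFDerivAt_iff_isLittleO_nhds_zero]
  refine Asymptotics.IsBigO.trans_isLittleO (g := fun h : E => ‖h‖ ^ 2) ?_
    (Asymptotics.isLittleO_norm_pow_id one_lt_two)
  refine Asymptotics.IsBigO.of_bound C ?_
  filter_upwards [Metric.closedBall_mem_nhds (0 : E) one_pos] with h hh
  have := hC h (by simpa using hh)
  simpa [translationRemainder, translateFDeriv_apply, add_comm] using this

/-- A continuous linear map on Schwartz functions is smooth along translations. -/
theorem contDiff_map_translate (W : 𝓢(E, F) →L[ℝ] G) (f : 𝓢(E, F)) :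
    ContDiff ℝ ∞ (fun y => W (f.compSubConstCLM ℝ (-y))) := by
  rw [contDiff_infty]
  intro n
  induction n generalizing f with
  | zero =>
    exact contDiff_zero.2 (continuous_iff_continuousAt.2 fun y =>
      (hasFDerivAt_map_translate W f y).continuousAt)
  | succ n ih =>
    rw [Nat.cast_succ]
    refine contDiff_succ_iff_fderiv_apply.2
      ⟨fun y => (hasFDerivAt_map_translate W f y).differentiableAt, fun h => by simp at h, fun v => ?_⟩
    simpa only [(hasFDerivAt_map_translate W f _).fderiv, translateFDeriv_apply,
      lineDerivOp_compSubConstCLM] using ih (∂_{v} f)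

end Translate

end SchwartzMap

/-- Pairing a tempered distribution `w` with the oscillatory family
`ξ ↦ e^{i⟨x,ξ⟩} b(x,ξ)`, where `b` is smooth and compactly supported, produces a Schwartz
function in `ξ` for each fixed `x`, and the resulting function `F(x) = w(e^{i⟨x,·⟩} b(x,·))`
is smooth in `x`. -/
theorem statement13 (d : ℕ) (hd : 1 ≤ d)
    (w : SchwartzMap (EuclideanSpace ℝ (Fin d)) ℂ →L[ℂ] ℂ)
    (b : EuclideanSpace ℝ (Fin d) × EuclideanSpace ℝ (Fin d) → ℂ)
    (hb : ContDiff ℝ (⊤ : ℕ∞) b) (hb' : HasCompactSupport b) :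
    ∃ G : EuclideanSpace ℝ (Fin d) → SchwartzMap (EuclideanSpace ℝ (Fin d)) ℂ,
      (∀ x ξ : EuclideanSpace ℝ (Fin d),
        G x ξ = Complex.exp (Complex.I * (⟪x, ξ⟫ : ℝ)) * b (x, ξ)) ∧
      ContDiff ℝ (⊤ : ℕ∞) (fun x => w (G x)) := by
  let E := EuclideanSpace ℝ (Fin d)
  let a : E × E → ℂ := fun p => Complex.exp (Complex.I * (⟪p.1, p.2⟫ : ℝ)) * b p
  have ha : ContDiff ℝ (⊤ : ℕ∞) a := by
    refine ContDiff.mul (ContDiff.cexp (contDiff_const.mul ?_)) hb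
    exact Complex.ofRealCLM.contDiff.comp (contDiff_fst.inner ℝ contDiff_snd)
  have ha' : HasCompactSupport a := hb'.mul_left
  let restrict : SchwartzMap (E × E) ℂ →L[ℝ] SchwartzMap E ℂ :=
    SchwartzMap.compCLMOfAntilipschitz ℝ (K := 1)
      (ContinuousLinearMap.inr ℝ E E).hasTemperateGrowth (fun x y => by simp [Prod.edist_eq])
  let W : SchwartzMap (E × E) ℂ →L[ℝ] ℂ := (w.restrictScalars ℝ).comp restrict
  let A : SchwartzMap (E × E) ℂ := ha'.toSchwartzMap ha
  refine ⟨fun x => restrict (A.compSubConstCLM ℝ (-(x, 0))), fun x ξ => ?_, ?_⟩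
  · change a ((0, ξ) - -(x, 0)) = _
    simp [a]
  · exact (SchwartzMap.contDiff_map_translate W A).comp
      (ContinuousLinearMap.inl ℝ E E).contDiff
end

section
/- Diagonal symbol estimates for the composed amplitude (convergent case): fix d ≥ 1, m₁ < −2d, and m₂ ∈ ℝ. Let φ₁ : ℝ^{2d} → ℝ be smooth and homogeneous of degree 1 outside the unit ball, i.e. φ₁(c·q) = c·φ₁(q) whenever c ≥ 1 and |q| ≥ 1. Let b₁, b₂ : ℝ^{2d} → ℂ be smooth with, for every multiindex α, |∂^α b_j(q)| ≤ C_{j,α}·(1 + |q|)^{m_j − |α|} (j = 1, 2). Define b(x, y, η) = ∫_{ℝ^d} ∫_{ℝ^d} e^{i(⟨z,ξ⟩ + φ₁(y+z, η+ξ) − φ₁(y, η))} · b₂(x, η) · b₁(y+z, η+ξ) dz dξ for x, y, η ∈ ℝ^d (the integral converges absolutely since m₁ < −2d). Then b is smooth, and its diagonal pullback (x, η) ↦ b(x, x, η) satisfies isotropic symbol estimates of order m₁ + m₂: for every multiindex α there is C_α with |∂^α_{x,η} (b(x, x, η))| ≤ C_α·(1 + |(x, η)|)^{m₁ + m₂ −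 |α|} for all (x, η) ∈ ℝ^d × ℝ^d. -/
open MeasureTheory
open scoped RealInnerProductSpace

section Symbols

lemma one_add_norm_pos {E : Type*} [SeminormedAddGroup E] (q : E) : 0 < 1 + ‖q‖ := by positivity

lemma nonneg_of_symbol_bound {E : Type*} [SeminormedAddGroup E] {g : E → ℝ} {C m : ℝ}
    (hg : ∀ q, 0 ≤ g q) (h : ∀ q, g q ≤ C * (1 + ‖q‖) ^ m) : 0 ≤ C := by
  simpa using (hg 0).trans (h 0)

variable {E : Type*} [NormedAddCommGroup E] [NormedSpace ℝ E]

/-- Isotropic symbols of order `m`. -/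
structure IsSymbol (m : ℝ) (f : E → ℂ) : Prop where
  contDiff : ContDiff ℝ (⊤ : ℕ∞) f
  bound : ∀ k : ℕ, ∃ C : ℝ, ∀ q, ‖iteratedFDeriv ℝ k f q‖ ≤ C * (1 + ‖q‖) ^ (m - k)

namespace IsSymbol

variable {m m' : ℝ} {f g : E → ℂ}

lemma differentiable (hf : IsSymbol m f) : Differentiable ℝ f :=
  hf.contDiff.differentiable (by simp)

lemma norm_le (hf : IsSymbol m f) : ∃ C : ℝ, ∀ q, ‖f q‖ ≤ C * (1 + ‖q‖) ^ m := by
  simpa using hf.bound 0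

lemma norm_fderiv_le (hf : IsSymbol m f) :
    ∃ C : ℝ, ∀ q, ‖fderiv ℝ f q‖ ≤ C * (1 + ‖q‖) ^ (m - 1) := by
  simpa using hf.bound 1

lemma mono (hf : IsSymbol m f) (h : m ≤ m') : IsSymbol m' f := by
  refine ⟨hf.contDiff, fun k => ?_⟩
  obtain ⟨C, hC⟩ := hf.bound k
  have hC0 := nonneg_of_symbol_bound (fun _ => norm_nonneg _) hC
  refine ⟨C, fun q => (hC q).trans ?_⟩
  gcongr
  linarith [norm_nonneg q]

lemma add (hf : IsSymbol m f) (hg : IsSymbol m g) : IsSymbol m (fun q => f q + g q) := by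
  refine ⟨hf.contDiff.add hg.contDiff, fun k => ?_⟩
  obtain ⟨C, hC⟩ := hf.bound k
  obtain ⟨D, hD⟩ := hg.bound k
  refine ⟨C + D, fun q => ?_⟩
  have : iteratedFDeriv ℝ k (fun q => f q + g q) q
      = iteratedFDeriv ℝ k f q + iteratedFDeriv ℝ k g q :=
    iteratedFDeriv_add_apply (hf.contDiff.of_le (by exact_mod_cast le_top)).contDiffAt
      (hg.contDiff.of_le (by exact_mod_cast le_top)).contDiffAt
  rw [this, add_mul]
  exact (norm_add_le _ _).trans (add_le_add (hC q) (hD q))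

lemma mul (hf : IsSymbol m f) (hg : IsSymbol m' g) :
    IsSymbol (m + m') (fun q => f q * g q) := by
  refine ⟨hf.contDiff.mul hg.contDiff, fun k => ?_⟩
  choose C hC using hf.bound
  choose D hD using hg.bound
  refine ⟨∑ i ∈ Finset.range (k + 1), k.choose i * C i * D (k - i), fun q => ?_⟩
  refine (norm_iteratedFDeriv_mul_le (hf.contDiff) hg.contDiff q
    (by exact_mod_cast le_top)).trans ?_
  rw [Finset.sum_mul]
  refine Finset.sum_le_sum fun i hi => ?_
  have hik : i ≤ k := Nat.lt_succ_iff.mp (Finset.mem_range.mp hi)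
  have hC0 := nonneg_of_symbol_bound (fun _ => norm_nonneg _) (hC i)
  calc (k.choose i : ℝ) * ‖iteratedFDeriv ℝ i f q‖ * ‖iteratedFDeriv ℝ (k - i) g q‖
      ≤ k.choose i * (C i * (1 + ‖q‖) ^ (m - i)) *
        (D (k - i) * (1 + ‖q‖) ^ (m' - (k - i : ℕ))) := by
        gcongr
        · exact hC i q
        · exact hD _ q
    _ = k.choose i * C i * D (k - i) *
        ((1 + ‖q‖) ^ (m - i) * (1 + ‖q‖) ^ (m' - (k - i : ℕ))) := by ring
    _ = _ := by
        rw [← Real.rpow_add (one_add_norm_pos q), Nat.cast_sub hik]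
        ring_nf

lemma clm_apply_fderiv (hf : IsSymbol m f) (v : E) :
    IsSymbol (m - 1) (fun q => fderiv ℝ f q v) := by
  have hd : ContDiff ℝ (⊤ : ℕ∞) (fderiv ℝ f) := hf.contDiff.fderiv_right (by simp)
  refine ⟨hd.clm_apply contDiff_const, fun k => ?_⟩
  obtain ⟨C, hC⟩ := hf.bound (k + 1)
  let L : (E →L[ℝ] ℂ) →L[ℝ] ℂ := ContinuousLinearMap.apply ℝ ℂ v
  refine ⟨‖L‖ * C, fun q => ?_⟩
  refine (L.norm_iteratedFDeriv_comp_left hd.contDiffAt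
    (N := (⊤ : ℕ∞)) (by exact_mod_cast le_top)).trans ?_
  rw [norm_iteratedFDeriv_fderiv, mul_assoc]
  gcongr
  have hk : m - 1 - k = m - (k + 1 : ℕ) := by push_cast; ring
  exact hk ▸ hC q

lemma const_mul (hf : IsSymbol m f) (a : ℂ) : IsSymbol m (fun q => a * f q) := by
  have : IsSymbol 0 (fun _ : E => a) := by
    refine ⟨contDiff_const, fun k => ?_⟩
    rcases k with _ | k
    · exact ⟨‖a‖, fun q => by simp⟩
    · exact ⟨0, fun q => by simp [iteratedFDeriv_const_of_ne (Nat.succ_ne_zero k)]⟩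
  simpa using this.mul hf

end IsSymbol

/-- A graded family of functions, bounded with the weight given by its index and stable under
directional derivatives with a gain of one order, consists of symbols. -/
theorem isSymbol_of_graded_family [FiniteDimensional ℝ E] (K : ℝ → (E → ℂ) → Prop)
    (hbound : ∀ m f, K m f → ∃ C : ℝ, ∀ q, ‖f q‖ ≤ C * (1 + ‖q‖) ^ m)
    (hdiff : ∀ m f, K m f → Differentiable ℝ f)
    (hderiv : ∀ m f, K m f → ∀ v, K (m - 1) (fun q => fderiv ℝ f q v))
    {m : ℝ} {f : E → ℂ} (hf : K m f) : IsSymbol m f := by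
  have smooth : ∀ n : ℕ, ∀ m f, K m f → ContDiff ℝ n f := by
    intro n
    induction n with
    | zero => intro m f hf; exact contDiff_zero.2 (hdiff m f hf).continuous
    | succ n ih =>
      intro m f hf
      push_cast
      rw [contDiff_succ_iff_fderiv_apply]
      exact ⟨hdiff m f hf, by simp, fun v => ih _ _ (hderiv m f hf v)⟩
  refine ⟨contDiff_infty.2 fun n => smooth n m f hf, fun k => ?_⟩
  induction k generalizing m f with
  | zero => simpa using hbound m f hf
  | succ k ih =>
    let e := Module.finBasis ℝ E
    let L : Fin (Module.finrank ℝ E) → ℂ →L[ℝ] (E →L[ℝ] ℂ) := fun i =>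
      ContinuousLinearMap.smulRightL ℝ E ℂ (LinearMap.toContinuousLinearMap (e.coord i))
    choose C hC using fun i => ih (hderiv m f hf (e i))
    refine ⟨∑ i, ‖L i‖ * C i, fun q => ?_⟩
    have hrep : fderiv ℝ f = fun q => ∑ i, (L i ∘ fun q => fderiv ℝ f q (e i)) q := by
      funext q
      ext v
      rw [← congrArg (fderiv ℝ f q) (e.sum_repr v), map_sum]
      simp [L]
    have hs : ∀ i, ContDiff ℝ k (fun q => fderiv ℝ f q (e i)) := fun i =>
      smooth k _ _ (hderiv m f hf (e i))
    rw [← norm_iteratedFDeriv_fderiv, hrep, iteratedFDeriv_fun_sum_apply]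
    · rw [Finset.sum_mul]
      refine norm_sum_le_of_le _ fun i _ => ?_
      refine ((L i).norm_iteratedFDeriv_comp_left (hs i).contDiffAt le_rfl).trans ?_
      rw [mul_assoc]
      gcongr
      have hk : m - (k + 1 : ℕ) = m - 1 - k := by push_cast; ring
      exact hk ▸ hC i q
    · exact fun i _ => ((L i).contDiff.comp (hs i)).contDiffAt

/-- A smooth function which is positively homogeneous of degree one outside the unit ball is a
symbol of order one. -/
theorem isSymbol_of_homogeneous [FiniteDimensional ℝ E] {f : E → ℂ}
    (hf : ContDiff ℝ (⊤ : ℕ∞) f)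
    (hom : ∀ c : ℝ, 1 ≤ c → ∀ q, 1 ≤ ‖q‖ → f (c • q) = c • f q) : IsSymbol 1 f := by
  refine ⟨hf, fun k => ?_⟩
  have hfk : ContDiff ℝ k f := hf.of_le (by exact_mod_cast le_top)
  have hcont : Continuous (iteratedFDeriv ℝ k f) := hf.continuous_iteratedFDeriv
    (by exact_mod_cast le_top)
  obtain ⟨C, hC⟩ := (isCompact_closedBall (0 : E) 2).exists_bound_of_continuousOn
    hcont.continuousOn
  have hC0 : 0 ≤ C := (norm_nonneg _).trans (hC 0 (by simp))
  have key : ∀ c : ℝ, 1 ≤ c → ∀ q : E, 1 < ‖q‖ →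
      ‖iteratedFDeriv ℝ k f (c • q)‖ = c ^ (1 - k : ℝ) * ‖iteratedFDeriv ℝ k f q‖ := by
    intro c hc q hq
    have hc0 : 0 < c := by linarith
    have h1 : (fun x => f (c • x)) =ᶠ[nhds q] fun x => c • f x := by
      filter_upwards [(isOpen_lt continuous_const continuous_norm).mem_nhds hq] with x hx
      exact hom c hc x (le_of_lt hx)
    have h2 := (h1.iteratedFDeriv ℝ k).self_of_nhds
    rw [iteratedFDeriv_comp_const_smul c hfk] at h2
    have h3 := congrArg norm h2
    rw [iteratedFDeriv_const_smul_apply' hfk.contDiffAt] at h3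
    simp only [norm_smul, norm_pow, Real.norm_of_nonneg hc0.le] at h3
    rw [Real.rpow_sub hc0, Real.rpow_one, Real.rpow_natCast]
    field_simp
    linarith
  refine ⟨C * (1 + 2 ^ (k : ℝ)) * 3 ^ (k : ℝ), fun q => ?_⟩
  have h3k : (1 : ℝ) ≤ 3 ^ (k : ℝ) := Real.one_le_rpow (by norm_num) (by positivity)
  have h2k : (0 : ℝ) < 2 ^ (k : ℝ) := by positivity
  rcases le_or_gt ‖q‖ 2 with hq | hq
  · have hCq : ‖iteratedFDeriv ℝ k f q‖ ≤ C := hC q (by simpa using hq)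
    have h4 : (1 : ℝ) ≤ 3 ^ (k : ℝ) * (1 + ‖q‖) ^ (1 - k : ℝ) := by
      rw [sub_eq_add_neg, Real.rpow_add (one_add_norm_pos q), Real.rpow_one,
        Real.rpow_neg (one_add_norm_pos q).le]
      have h5 : (1 + ‖q‖) ^ (k : ℝ) ≤ 3 ^ (k : ℝ) := by gcongr; linarith
      have h6 : 0 < (1 + ‖q‖) ^ (k : ℝ) := by positivity
      have h7 : 1 ≤ 3 ^ (k : ℝ) * ((1 + ‖q‖) ^ (k : ℝ))⁻¹ := by
        rw [← div_eq_mul_inv, one_le_div h6]; exact h5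
      nlinarith [norm_nonneg q]
    calc ‖iteratedFDeriv ℝ k f q‖ ≤ C := hCq
      _ ≤ C * (1 + 2 ^ (k : ℝ)) := by nlinarith
      _ ≤ C * (1 + 2 ^ (k : ℝ)) * (3 ^ (k : ℝ) * (1 + ‖q‖) ^ (1 - k : ℝ)) :=
        le_mul_of_one_le_right (by positivity) h4
      _ = _ := by ring
  · have hq0 : 0 < ‖q‖ := by linarith
    set r : E := (2 / ‖q‖) • q with hr
    have hrn : ‖r‖ = 2 := by
      rw [hr, norm_smul, Real.norm_of_nonneg (by positivity)]; field_simp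
    have hqr : q = (‖q‖ / 2) • r := by
      rw [hr, smul_smul]; field_simp; simp
    have hk := key (‖q‖ / 2) (by linarith) r (by rw [hrn]; norm_num)
    rw [← hqr] at hk
    have hCr := hC r (by simp [hrn])
    have h4 : (‖q‖ / 2) ^ (1 - k : ℝ) ≤ 2 ^ (k : ℝ) * 3 ^ (k : ℝ) * (1 + ‖q‖) ^ (1 - k : ℝ) := by
      have hp : 0 < ‖q‖ / 2 := by positivity
      rw [Real.rpow_sub hp, Real.rpow_sub (one_add_norm_pos q), Real.rpow_one, Real.rpow_one]
      have h5 : (1 + ‖q‖) ^ (k : ℝ) ≤ 2 ^ (k : ℝ) * 3 ^ (k : ℝ) * (‖q‖ / 2) ^ (k : ℝ) := by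
        rw [← Real.mul_rpow (by norm_num) (by norm_num), ← Real.mul_rpow (by norm_num) hp.le]
        gcongr
        linarith
      have h6 : 0 < (1 + ‖q‖) ^ (k : ℝ) := by positivity
      rw [div_le_iff₀ (by positivity)]
      have : 2 ^ (k : ℝ) * 3 ^ (k : ℝ) * ((1 + ‖q‖) / (1 + ‖q‖) ^ (k : ℝ)) * (‖q‖ / 2) ^ (k : ℝ)
        = (1 + ‖q‖) * ((2 ^ (k : ℝ) * 3 ^ (k : ℝ) * (‖q‖ / 2) ^ (k : ℝ)) /
          (1 + ‖q‖) ^ (k : ℝ)) := by ring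
      rw [this]
      have h7 : 1 ≤ (2 ^ (k : ℝ) * 3 ^ (k : ℝ) * (‖q‖ / 2) ^ (k : ℝ)) / (1 + ‖q‖) ^ (k : ℝ) := by
        rw [one_le_div h6]; exact h5
      nlinarith
    calc ‖iteratedFDeriv ℝ k f q‖ = (‖q‖ / 2) ^ (1 - k : ℝ) * ‖iteratedFDeriv ℝ k f r‖ := hk
      _ ≤ (2 ^ (k : ℝ) * 3 ^ (k : ℝ) * (1 + ‖q‖) ^ (1 - k : ℝ)) * C := by gcongr
      _ ≤ ((1 + 2 ^ (k : ℝ)) * 3 ^ (k : ℝ) * (1 + ‖q‖) ^ (1 - k : ℝ)) * C := by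
        gcongr; linarith
      _ = _ := by ring

end Symbols

section Amplitudes

variable {E : Type*} [NormedAddCommGroup E] [NormedSpace ℝ E]

/-- Peetre's inequality for nonpositive exponents. -/
lemma one_add_norm_add_rpow_le {E : Type*} [SeminormedAddCommGroup E] (q w : E) {m : ℝ}
    (hm : m ≤ 0) :
    (1 + ‖q + w‖) ^ m ≤ (1 + ‖q‖) ^ m * (1 + ‖w‖) ^ (-m) := by
  have h1 : 1 + ‖q‖ ≤ (1 + ‖q + w‖) * (1 + ‖w‖) := by
    have : ‖q‖ ≤ ‖q + w‖ + ‖w‖ := by simpa using norm_sub_le (q + w) w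
    nlinarith [norm_nonneg (q + w), norm_nonneg w]
  have h2 := Real.rpow_le_rpow_of_nonpos (one_add_norm_pos q) h1 hm
  rw [Real.mul_rpow (one_add_norm_pos _).le (one_add_norm_pos _).le] at h2
  have h3 : 0 < (1 + ‖w‖) ^ m := Real.rpow_pos_of_pos (one_add_norm_pos w) m
  rw [Real.rpow_neg (one_add_norm_pos w).le, ← div_eq_mul_inv, le_div_iff₀ h3]
  exact h2

/-- Increments of a symbol of order `-n ≤ 0` gain one order in the base point, at the cost of a
polynomial factor in the increment. -/
lemma IsSymbol.norm_sub_le {n : ℝ} (hn : 0 ≤ n) {c : E → ℂ} (hc : IsSymbol (-n) c) :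
    ∃ C : ℝ, 0 ≤ C ∧ ∀ q w : E,
      ‖c (q + w) - c q‖ ≤ C * ((1 + ‖q‖) ^ (-n - 1) * (1 + ‖w‖) ^ (n + 1)) := by
  obtain ⟨C, hC⟩ := hc.norm_le
  obtain ⟨D, hD⟩ := hc.norm_fderiv_le
  have hC0 := nonneg_of_symbol_bound (fun _ => norm_nonneg _) hC
  have hD0 := nonneg_of_symbol_bound (fun _ => norm_nonneg _) hD
  have hc1 : ∀ q, ‖c q‖ ≤ C := fun q => (hC q).trans <| mul_le_of_le_one_right hC0 <|
    Real.rpow_le_one_of_one_le_of_nonpos (by linarith [norm_nonneg q]) (by linarith)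
  have h2pos : (0 : ℝ) < 2 ^ (n + 1) := by positivity
  refine ⟨(2 * C + D) * 2 ^ (n + 1), by positivity, fun q w => ?_⟩
  have hqpos := one_add_norm_pos q
  have hneg : (1 + ‖q‖) ^ (-n - 1) = ((1 + ‖q‖) ^ (n + 1))⁻¹ := by
    rw [← Real.rpow_neg hqpos.le]; ring_nf
  have hA : 0 < (1 + ‖q‖) ^ (n + 1) := by positivity
  have hB : 0 < (1 + ‖w‖) ^ (n + 1) := by positivity
  rcases le_or_gt ((1 + ‖q‖) / 2) ‖w‖ with h | h
  · have h1 : 1 ≤ 2 ^ (n + 1) * ((1 + ‖q‖) ^ (-n - 1) * (1 + ‖w‖) ^ (n + 1)) := by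
      have : (1 + ‖q‖) ^ (n + 1) ≤ 2 ^ (n + 1) * (1 + ‖w‖) ^ (n + 1) := by
        rw [← Real.mul_rpow (by norm_num) (one_add_norm_pos w).le]
        gcongr
        linarith
      rw [hneg]
      field_simp
      linarith
    calc ‖c (q + w) - c q‖ ≤ ‖c (q + w)‖ + ‖c q‖ := _root_.norm_sub_le _ _
      _ ≤ 2 * C + D := by linarith [hc1 q, hc1 (q + w)]
      _ ≤ (2 * C + D) * (2 ^ (n + 1) * ((1 + ‖q‖) ^ (-n - 1) * (1 + ‖w‖) ^ (n + 1))) :=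
        le_mul_of_one_le_right (by positivity) h1
      _ = _ := by ring
  · have hball : ∀ x ∈ Metric.closedBall q ‖w‖,
        ‖fderiv ℝ c x‖ ≤ D * (2 ^ (n + 1) * (1 + ‖q‖) ^ (-n - 1)) := by
      intro x hx
      refine (hD x).trans (mul_le_mul_of_nonneg_left ?_ hD0)
      have hx' : ‖q‖ ≤ ‖x‖ + ‖w‖ := by
        have h1 : ‖q‖ - ‖x‖ ≤ ‖q - x‖ := norm_sub_norm_le q x
        rw [Metric.mem_closedBall, dist_eq_norm, norm_sub_rev] at hx
        linarith
      have h3 : (1 + ‖q‖) / 2 ≤ 1 + ‖x‖ := by linarith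
      calc (1 + ‖x‖) ^ (-n - 1) ≤ ((1 + ‖q‖) / 2) ^ (-n - 1) :=
            Real.rpow_le_rpow_of_nonpos (by positivity) h3 (by linarith)
        _ = 2 ^ (n + 1) * (1 + ‖q‖) ^ (-n - 1) := by
            rw [Real.div_rpow hqpos.le (by norm_num), show -n - 1 = -(n + 1) by ring,
              Real.rpow_neg (by norm_num : (0 : ℝ) ≤ 2)]
            field_simp
    have hmv := (convex_closedBall q ‖w‖).norm_image_sub_le_of_norm_fderiv_le
      (fun x _ => hc.differentiable x) hball (Metric.mem_closedBall_self (norm_nonneg w))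
      (y := q + w) (by simp)
    have hw : ‖w‖ ≤ (1 + ‖w‖) ^ (n + 1) :=
      (by linarith : ‖w‖ ≤ 1 + ‖w‖).trans
        (Real.self_le_rpow_of_one_le (by linarith [norm_nonneg w]) (by linarith))
    have hP : 0 < (1 + ‖q‖) ^ (-n - 1) := by positivity
    calc ‖c (q + w) - c q‖
        ≤ D * (2 ^ (n + 1) * (1 + ‖q‖) ^ (-n - 1)) * ‖w‖ := by simpa using hmv
      _ ≤ (2 * C + D) * (2 ^ (n + 1) * (1 + ‖q‖) ^ (-n - 1)) * (1 + ‖w‖) ^ (n + 1) := by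
          gcongr; linarith
      _ = _ := by ring

/-- Two-point amplitudes `F (q, w)` attached to the phase `φ`, graded by their order in `q`: they
are generated by `exp (i (φ (q + w) - φ q)) b (q + w)` with `b` a symbol, and by multiplication
with increments `c (q + w) - c q` of symbols of nonpositive order. -/
inductive Amplitude (φ : E → ℝ) (m₁ : ℝ) : ℝ → (E × E → ℂ) → Prop
  | base {m : ℝ} {b : E → ℂ} (hm : m ≤ m₁) (hb : IsSymbol m b) :
      Amplitude φ m₁ m (fun p =>
        Complex.exp (Complex.I * ((φ (p.1 + p.2) : ℂ) - φ p.1)) * b (p.1 + p.2))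
  | mul_diff {σ τ n : ℝ} {g : E × E → ℂ} {c : E → ℂ} (hg : Amplitude φ m₁ σ g) (hn : 0 ≤ n)
      (hc : IsSymbol (-n) c) (hτ : τ = σ - n - 1) :
      Amplitude φ m₁ τ (fun p => g p * (c (p.1 + p.2) - c p.1))
  | add {σ : ℝ} {g h : E × E → ℂ} (hg : Amplitude φ m₁ σ g) (hh : Amplitude φ m₁ σ h) :
      Amplitude φ m₁ σ (fun p => g p + h p)

lemma hasFDerivAt_comp_fst_add_snd {a : E → ℂ} (ha : Differentiable ℝ a) (p : E × E) :
    HasFDerivAt (fun p : E × E => a (p.1 + p.2))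
      ((fderiv ℝ a (p.1 + p.2)).comp
        (ContinuousLinearMap.fst ℝ E E + ContinuousLinearMap.snd ℝ E E)) p :=
  (ha (p.1 + p.2)).hasFDerivAt.comp p (hasFDerivAt_fst.add hasFDerivAt_snd)

lemma hasFDerivAt_comp_fst {a : E → ℂ} (ha : Differentiable ℝ a) (p : E × E) :
    HasFDerivAt (fun p : E × E => a p.1)
      ((fderiv ℝ a p.1).comp (ContinuousLinearMap.fst ℝ E E)) p :=
  (ha p.1).hasFDerivAt.comp p hasFDerivAt_fst

lemma fderiv_phase_mul_apply {φ : E → ℝ} {b : E → ℂ}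
    (hφ : Differentiable ℝ (fun q => (φ q : ℂ))) (hb : Differentiable ℝ b) (p w : E × E) :
    fderiv ℝ (fun p : E × E =>
      Complex.exp (Complex.I * ((φ (p.1 + p.2) : ℂ) - φ p.1)) * b (p.1 + p.2)) p w =
    Complex.exp (Complex.I * ((φ (p.1 + p.2) : ℂ) - φ p.1)) *
      (Complex.I * (fderiv ℝ (fun q => (φ q : ℂ)) (p.1 + p.2) (w.1 + w.2)
        - fderiv ℝ (fun q => (φ q : ℂ)) p.1 w.1) * b (p.1 + p.2)
        + fderiv ℝ b (p.1 + p.2) (w.1 + w.2)) := by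
  have h : HasFDerivAt (fun p : E × E =>
      Complex.exp (Complex.I * ((φ (p.1 + p.2) : ℂ) - φ p.1)) * b (p.1 + p.2)) _ p :=
    ((((hasFDerivAt_comp_fst_add_snd hφ p).sub
      (hasFDerivAt_comp_fst hφ p)).const_mul Complex.I).cexp).mul
      (hasFDerivAt_comp_fst_add_snd hb p)
  rw [h.fderiv]
  simp
  ring

lemma fderiv_mul_diff_apply {g : E × E → ℂ} {c : E → ℂ}
    (hg : Differentiable ℝ g) (hc : Differentiable ℝ c) (p w : E × E) :
    fderiv ℝ (fun p : E × E => g p * (c (p.1 + p.2) - c p.1)) p w =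
    fderiv ℝ g p w * (c (p.1 + p.2) - c p.1)
      + g p * (fderiv ℝ c (p.1 + p.2) (w.1 + w.2) - fderiv ℝ c p.1 w.1) := by
  have h : HasFDerivAt (fun p : E × E => g p * (c (p.1 + p.2) - c p.1)) _ p :=
    (hg p).hasFDerivAt.mul
      ((hasFDerivAt_comp_fst_add_snd hc p).sub (hasFDerivAt_comp_fst hc p))
  rw [h.fderiv]
  simp
  ring

namespace Amplitude

variable {φ : E → ℝ} {m₁ σ : ℝ} {g : E × E → ℂ}

lemma contDiff (hφ : IsSymbol 1 (fun q => (φ q : ℂ))) (hg : Amplitude φ m₁ σ g) :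
    ContDiff ℝ (⊤ : ℕ∞) g := by
  induction hg with
  | base hm hb =>
    have h1 : ContDiff ℝ (⊤ : ℕ∞) (fun p : E × E => (φ (p.1 + p.2) : ℂ)) :=
      hφ.contDiff.comp (contDiff_fst.add contDiff_snd)
    have h2 : ContDiff ℝ (⊤ : ℕ∞) (fun p : E × E => (φ p.1 : ℂ)) :=
      hφ.contDiff.comp contDiff_fst
    exact (contDiff_const.mul (h1.sub h2)).cexp.mul
      (hb.contDiff.comp (contDiff_fst.add contDiff_snd))
  | mul_diff hg hn hc hτ ih =>
    exact ih.mul ((hc.contDiff.comp (contDiff_fst.add contDiff_snd)).sub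
      (hc.contDiff.comp contDiff_fst))
  | add hg hh ih1 ih2 => exact ih1.add ih2

lemma differentiable (hφ : IsSymbol 1 (fun q => (φ q : ℂ))) (hg : Amplitude φ m₁ σ g) :
    Differentiable ℝ g :=
  (hg.contDiff hφ).differentiable (by simp)

lemma norm_phase {E : Type*} [Add E] {φ : E → ℝ} (p : E × E) :
    ‖Complex.exp (Complex.I * ((φ (p.1 + p.2) : ℂ) - φ p.1))‖ = 1 := by
  rw [← Complex.ofReal_sub]
  exact Complex.norm_exp_I_mul_ofReal _

lemma norm_le (hm₁ : m₁ ≤ 0) (hg : Amplitude φ m₁ σ g) :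
    ∃ C : ℝ, 0 ≤ C ∧ ∀ p, ‖g p‖ ≤ C * ((1 + ‖p.1‖) ^ σ * (1 + ‖p.2‖) ^ (-σ)) := by
  induction hg with
  | base hm hb =>
    obtain ⟨C, hC⟩ := hb.norm_le
    have hC0 := nonneg_of_symbol_bound (fun _ => norm_nonneg _) hC
    refine ⟨C, hC0, fun p => ?_⟩
    rw [norm_mul, norm_phase, one_mul]
    exact (hC _).trans (mul_le_mul_of_nonneg_left
      (one_add_norm_add_rpow_le _ _ (hm.trans hm₁)) hC0)
  | @mul_diff σ τ n g c hg hn hc hτ ih =>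
    obtain ⟨C, hC0, hC⟩ := ih
    obtain ⟨D, hD0, hD⟩ := hc.norm_sub_le hn
    refine ⟨C * D, by positivity, fun p => ?_⟩
    rw [norm_mul]
    refine (mul_le_mul (hC p) (hD p.1 p.2) (norm_nonneg _) (by positivity)).trans_eq ?_
    rw [hτ, show σ - n - 1 = σ + (-n - 1) by ring, show -(σ + (-n - 1)) = -σ + (n + 1) by ring,
      Real.rpow_add (one_add_norm_pos _) σ, Real.rpow_add (one_add_norm_pos _) (-σ)]
    ring
  | add hg hh ih1 ih2 =>
    obtain ⟨C, hC0, hC⟩ := ih1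
    obtain ⟨D, hD0, hD⟩ := ih2
    refine ⟨C + D, by positivity, fun p => ?_⟩
    rw [add_mul]
    exact (norm_add_le _ _).trans (add_le_add (hC p) (hD p))

lemma norm_le_integrable (hg : Amplitude φ m₁ σ g) :
    ∃ C : ℝ, 0 ≤ C ∧ ∀ p, ‖g p‖ ≤ C * (1 + ‖p.1 + p.2‖) ^ m₁ := by
  induction hg with
  | base hm hb =>
    obtain ⟨C, hC⟩ := (hb.mono hm).norm_le
    have hC0 := nonneg_of_symbol_bound (fun _ => norm_nonneg _) hC
    refine ⟨C, hC0, fun p => ?_⟩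
    rw [norm_mul, norm_phase, one_mul]
    exact hC _
  | @mul_diff σ τ n g c hg hn hc hτ ih =>
    obtain ⟨C, hC0, hC⟩ := ih
    obtain ⟨D, hD⟩ := (hc.mono (neg_nonpos.2 hn)).norm_le
    have hD0 := nonneg_of_symbol_bound (fun _ => norm_nonneg _) hD
    simp only [Real.rpow_zero, mul_one] at hD
    refine ⟨C * (2 * D), by positivity, fun p => ?_⟩
    rw [norm_mul]
    calc ‖g p‖ * ‖c (p.1 + p.2) - c p.1‖ ≤ C * (1 + ‖p.1 + p.2‖) ^ m₁ * (2 * D) := by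
          gcongr
          · exact hC p
          · exact (norm_sub_le _ _).trans (by linarith [hD (p.1 + p.2), hD p.1])
      _ = _ := by ring
  | add hg hh ih1 ih2 =>
    obtain ⟨C, hC0, hC⟩ := ih1
    obtain ⟨D, hD0, hD⟩ := ih2
    refine ⟨C + D, by positivity, fun p => ?_⟩
    rw [add_mul]
    exact (norm_add_le _ _).trans (add_le_add (hC p) (hD p))

lemma mul_symbol (hg : Amplitude φ m₁ σ g) {n τ : ℝ} (hn : 0 ≤ n) {a : E → ℂ}
    (ha : IsSymbol (-n) a) (hτ : τ = σ - n) :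
    Amplitude φ m₁ τ (fun p => g p * a (p.1 + p.2)) := by
  induction hg generalizing τ with
  | @base m b hm hb =>
    have hba : IsSymbol τ (fun q => b q * a q) := by
      rw [hτ, sub_eq_add_neg]; exact hb.mul ha
    simpa only [mul_assoc] using Amplitude.base (φ := φ) (m₁ := m₁) (by linarith) hba
  | @mul_diff σ' τ' k g c hg hk hc hτ' ih =>
    convert! Amplitude.mul_diff (ih rfl) hk hc (by linarith) using 2
    ring
  | add hg hh ih1 ih2 =>
    convert! Amplitude.add (ih1 hτ) (ih2 hτ) using 2 with p
    exact add_mul _ _ _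

/-- Derivatives in the integration variable preserve the order. -/
lemma fderiv_snd (hφ : IsSymbol 1 (fun q => (φ q : ℂ))) (hg : Amplitude φ m₁ σ g) (u : E) :
    Amplitude φ m₁ σ (fun p => fderiv ℝ g p (0, u)) := by
  have hφ' : IsSymbol 0 (fun q => fderiv ℝ (fun q => (φ q : ℂ)) q u) := by
    simpa using hφ.clm_apply_fderiv u
  induction hg with
  | @base m b hm hb =>
    have hb' : IsSymbol m (fun q => Complex.I * (fderiv ℝ (fun q => (φ q : ℂ)) q u * b q)
        + fderiv ℝ b q u) := by
      refine IsSymbol.add (IsSymbol.const_mul ?_ _)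
        ((hb.clm_apply_fderiv u).mono (by linarith))
      simpa using hφ'.mul hb
    convert! Amplitude.base (φ := φ) hm hb' using 2 with p
    rw [fderiv_phase_mul_apply hφ.differentiable hb.differentiable]
    simp
    ring
  | @mul_diff σ τ n g c hg hn hc hτ ih =>
    have hc' : IsSymbol (-(n + 1)) (fun q => fderiv ℝ c q u) := by
      rw [neg_add']; exact hc.clm_apply_fderiv u
    convert! (ih.mul_diff hn hc hτ).add
      (hg.mul_symbol (by linarith) hc' (by rw [hτ]; ring)) using 2 with p
    rw [fderiv_mul_diff_apply (hg.differentiable hφ) hc.differentiable]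
    simp
  | add hg hh ih1 ih2 =>
    convert! ih1.add ih2 using 2 with p
    rw [fderiv_fun_add (hg.differentiable hφ p) (hh.differentiable hφ p)]
    simp

/-- Derivatives in the base point lower the order by one. -/
lemma fderiv_fst (hφ : IsSymbol 1 (fun q => (φ q : ℂ))) (hg : Amplitude φ m₁ σ g) (v : E) :
    Amplitude φ m₁ (σ - 1) (fun p => fderiv ℝ g p (v, 0)) := by
  have hφ' : IsSymbol (-0) (fun q => Complex.I * fderiv ℝ (fun q => (φ q : ℂ)) q v) := by
    simpa using (hφ.clm_apply_fderiv v).const_mul Complex.I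
  induction hg with
  | @base m b hm hb =>
    convert! (Amplitude.base (φ := φ) (by linarith) (hb.clm_apply_fderiv v)).add
      ((Amplitude.base (φ := φ) hm hb).mul_diff le_rfl hφ' (by ring)) using 2 with p
    rw [fderiv_phase_mul_apply hφ.differentiable hb.differentiable]
    simp
    ring
  | @mul_diff σ τ n g c hg hn hc hτ ih =>
    have hc' : IsSymbol (-(n + 1)) (fun q => fderiv ℝ c q v) := by
      rw [neg_add']; exact hc.clm_apply_fderiv v
    convert! (ih.mul_diff (τ := τ - 1) hn hc (by rw [hτ]; ring)).add
      (hg.mul_diff (τ := τ - 1) (by linarith) hc' (by rw [hτ]; ring)) using 2 with p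
    rw [fderiv_mul_diff_apply (hg.differentiable hφ) hc.differentiable]
    simp
  | add hg hh ih1 ih2 =>
    convert! ih1.add ih2 using 2 with p
    rw [fderiv_fun_add (hg.differentiable hφ p) (hh.differentiable hφ p)]
    simp

end Amplitude

end Amplitudes

section OscillatoryIntegrals

variable {E : Type*} [NormedAddCommGroup E] [NormedSpace ℝ E] {ι : Type*} [Fintype ι]

/-- `Q` is a smooth phase whose derivatives in the directions `u i` are the linear forms `ℓ i`,
and these linear forms control the norm. -/
structure IsQuadraticPhase (Q : E → ℝ) (u : ι → E) (ℓ : ι → E →L[ℝ] ℝ) : Prop where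
  contDiff : ContDiff ℝ (⊤ : ℕ∞) Q
  fderiv_apply : ∀ i w, fderiv ℝ Q w (u i) = ℓ i w
  lower_bound : ∃ κ : ℝ, 0 < κ ∧ ∀ w, κ * (1 + ‖w‖) ^ 2 ≤ 1 + ∑ i, ℓ i w ^ 2

/-- The inverse of the elliptic polynomial `1 + ∑ i, (ℓ i) ^ 2`. -/
noncomputable def invWeight (ℓ : ι → E →L[ℝ] ℝ) (w : E) : ℂ :=
  (1 + ∑ i, Complex.ofRealCLM.comp (ℓ i) w ^ 2)⁻¹

/-- Weights of order `a`, generated by `1`, linear forms (of order `1`) and `invWeight`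
(of order `-2`). -/
inductive Weight (ℓ : ι → E →L[ℝ] ℝ) : ℝ → (E → ℂ) → Prop
  | one : Weight ℓ 0 (fun _ => 1)
  | mul_const {a : ℝ} {ρ : E → ℂ} (hρ : Weight ℓ a ρ) (z : ℂ) : Weight ℓ a (fun w => ρ w * z)
  | add {a : ℝ} {ρ θ : E → ℂ} (hρ : Weight ℓ a ρ) (hθ : Weight ℓ a θ) :
      Weight ℓ a (fun w => ρ w + θ w)
  | mul_clm {a a' : ℝ} {ρ : E → ℂ} (hρ : Weight ℓ a ρ) (L : E →L[ℝ] ℂ) (ha : a' = a + 1) :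
      Weight ℓ a' (fun w => ρ w * L w)
  | mul_inv {a a' : ℝ} {ρ : E → ℂ} (hρ : Weight ℓ a ρ) (ha : a' = a - 2) :
      Weight ℓ a' (fun w => ρ w * invWeight ℓ w)

lemma one_add_sum_sq_eq_ofReal (ℓ : ι → E →L[ℝ] ℝ) (w : E) :
    1 + ∑ i, Complex.ofRealCLM.comp (ℓ i) w ^ 2 = ((1 + ∑ i, ℓ i w ^ 2 : ℝ) : ℂ) := by
  simp

lemma one_add_sum_sq_ne_zero (ℓ : ι → E →L[ℝ] ℝ) (w : E) :
    1 + ∑ i, Complex.ofRealCLM.comp (ℓ i) w ^ 2 ≠ 0 := by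
  rw [one_add_sum_sq_eq_ofReal, Complex.ofReal_ne_zero]
  positivity

lemma contDiff_invWeight (ℓ : ι → E →L[ℝ] ℝ) : ContDiff ℝ (⊤ : ℕ∞) (invWeight ℓ) := by
  refine ContDiff.inv ?_ (one_add_sum_sq_ne_zero ℓ)
  exact contDiff_const.add (ContDiff.sum fun i _ => (ContinuousLinearMap.contDiff _).pow 2)

lemma fderiv_invWeight_apply (ℓ : ι → E →L[ℝ] ℝ) (w v : E) :
    fderiv ℝ (invWeight ℓ) w v = invWeight ℓ w * invWeight ℓ w *
      (∑ i, (-(2 * ℓ i v)) • Complex.ofRealCLM.comp (ℓ i)) w := by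
  have hs : HasFDerivAt (fun w => 1 + ∑ i, Complex.ofRealCLM.comp (ℓ i) w ^ 2)
      (∑ i, (2 * Complex.ofRealCLM.comp (ℓ i) w) • Complex.ofRealCLM.comp (ℓ i)) w := by
    refine HasFDerivAt.const_add _ (HasFDerivAt.fun_sum fun i _ => ?_)
    simpa using ((Complex.ofRealCLM.comp (ℓ i)).hasFDerivAt (x := w)).pow 2
  have hJ : HasFDerivAt (invWeight ℓ) _ w :=
    (hasFDerivAt_inv' (𝕜 := ℝ) (one_add_sum_sq_ne_zero ℓ w)).comp w hs
  rw [hJ.fderiv]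
  simp [invWeight, Finset.mul_sum]
  refine Finset.sum_congr rfl fun i _ => ?_
  ring

namespace Weight

variable {ℓ : ι → E →L[ℝ] ℝ} {a : ℝ} {ρ : E → ℂ}

lemma contDiff (hρ : Weight ℓ a ρ) : ContDiff ℝ (⊤ : ℕ∞) ρ := by
  induction hρ with
  | one => exact contDiff_const
  | add hρ hθ ih1 ih2 => exact ih1.add ih2
  | mul_const hρ z ih => exact ih.mul contDiff_const
  | mul_clm hρ L ha ih => exact ih.mul L.contDiff
  | mul_inv hρ ha ih => exact ih.mul (contDiff_invWeight ℓ)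

lemma differentiable (hρ : Weight ℓ a ρ) : Differentiable ℝ ρ :=
  hρ.contDiff.differentiable (by simp)

lemma norm_le {Q : E → ℝ} {u : ι → E} (hQ : IsQuadraticPhase Q u ℓ) (hρ : Weight ℓ a ρ) :
    ∃ C : ℝ, 0 ≤ C ∧ ∀ w, ‖ρ w‖ ≤ C * (1 + ‖w‖) ^ a := by
  obtain ⟨κ, hκ, hlow⟩ := hQ.lower_bound
  induction hρ with
  | one => exact ⟨1, zero_le_one, by simp⟩
  | add hρ hθ ih1 ih2 =>
    obtain ⟨C, hC0, hC⟩ := ih1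
    obtain ⟨D, hD0, hD⟩ := ih2
    refine ⟨C + D, by positivity, fun w => ?_⟩
    rw [add_mul]
    exact (norm_add_le _ _).trans (add_le_add (hC w) (hD w))
  | mul_const hρ z ih =>
    obtain ⟨C, hC0, hC⟩ := ih
    refine ⟨C * ‖z‖, by positivity, fun w => ?_⟩
    rw [norm_mul, mul_right_comm]
    exact mul_le_mul_of_nonneg_right (hC w) (norm_nonneg z)
  | @mul_clm a a' ρ hρ L ha ih =>
    obtain ⟨C, hC0, hC⟩ := ih
    refine ⟨C * ‖L‖, by positivity, fun w => ?_⟩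
    have hL : ‖L w‖ ≤ ‖L‖ * (1 + ‖w‖) := (L.le_opNorm w).trans (by gcongr; simp)
    rw [norm_mul, ha, Real.rpow_add (one_add_norm_pos w), Real.rpow_one]
    refine (mul_le_mul (hC w) hL (norm_nonneg _) (by positivity)).trans_eq (by ring)
  | @mul_inv a a' ρ hρ ha ih =>
    obtain ⟨C, hC0, hC⟩ := ih
    refine ⟨C * κ⁻¹, by positivity, fun w => ?_⟩
    have hw := one_add_norm_pos w
    have hJ : ‖invWeight ℓ w‖ ≤ κ⁻¹ * ((1 + ‖w‖) ^ 2)⁻¹ := by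
      rw [invWeight, one_add_sum_sq_eq_ofReal, norm_inv, Complex.norm_real,
        Real.norm_of_nonneg (by positivity), ← _root_.mul_inv]
      exact inv_anti₀ (by positivity) (hlow w)
    rw [norm_mul, ha, Real.rpow_sub hw, Real.rpow_ofNat]
    refine (mul_le_mul (hC w) hJ (norm_nonneg _) (by positivity)).trans_eq (by ring)

lemma fderiv_apply (hρ : Weight ℓ a ρ) (v : E) {a' : ℝ} (ha' : a' = a - 1) :
    Weight ℓ a' (fun w => fderiv ℝ ρ w v) := by
  induction hρ generalizing a' with
  | one =>
    convert! ((Weight.one (ℓ := ℓ)).mul_clm (0 : E →L[ℝ] ℂ) rfl).mul_inv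
      (a' := a') (by rw [ha']; ring) using 2 with w
    simp
  | add hρ hθ ih1 ih2 =>
    convert! (ih1 ha').add (ih2 ha') using 2 with w
    rw [fderiv_fun_add (hρ.differentiable w) (hθ.differentiable w)]
    simp
  | @mul_const a ρ hρ z ih =>
    convert! (ih ha').mul_const z using 2 with w
    rw [fderiv_mul_const (hρ.differentiable w)]
    simp [mul_comm]
  | @mul_clm a a₁ ρ hρ L ha ih =>
    obtain rfl : a' = a := by rw [ha', ha]; ring
    convert! ((ih rfl).mul_clm L (a' := a') (by ring)).add (hρ.mul_const (L v)) using 2 with w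
    rw [fderiv_fun_mul (hρ.differentiable w) L.differentiableAt]
    simp only [add_apply, smul_apply, smul_eq_mul, ContinuousLinearMap.fderiv]
    ring
  | @mul_inv a a₁ ρ hρ ha ih =>
    convert! ((ih rfl).mul_inv (a' := a') (by rw [ha', ha]; ring)).add
      (((hρ.mul_inv rfl).mul_inv rfl).mul_clm
        (∑ i, (-(2 * ℓ i v)) • Complex.ofRealCLM.comp (ℓ i)) (a' := a')
        (by rw [ha', ha]; ring)) using 2 with w
    rw [fderiv_fun_mul (hρ.differentiable w)
      ((contDiff_invWeight ℓ).differentiable (by simp) w)]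
    simp only [add_apply, smul_apply, smul_eq_mul,
      fderiv_invWeight_apply]
    ring

end Weight

end OscillatoryIntegrals

section OscillatoryEstimates

variable {E : Type*} [NormedAddCommGroup E] [NormedSpace ℝ E] {ι : Type*} [Fintype ι]
  {Q : E → ℝ} {u : ι → E} {ℓ : ι → E →L[ℝ] ℝ} {φ : E → ℝ} {m₁ σ a : ℝ}
  {F : E × E → ℂ} {ρ : E → ℂ}

lemma IsQuadraticPhase.contDiff_exp (hQ : IsQuadraticPhase Q u ℓ) :
    ContDiff ℝ (⊤ : ℕ∞) (fun w => Complex.exp (Complex.I * Q w)) :=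
  (contDiff_const.mul (Complex.ofRealCLM.contDiff.comp hQ.contDiff)).cexp

lemma IsQuadraticPhase.fderiv_exp_apply (hQ : IsQuadraticPhase Q u ℓ) (i : ι) (w : E) :
    fderiv ℝ (fun w => Complex.exp (Complex.I * Q w)) w (u i) =
      Complex.exp (Complex.I * Q w) * (Complex.I * ℓ i w) := by
  have h1 : HasFDerivAt (fun w => (Q w : ℂ)) (Complex.ofRealCLM.comp (fderiv ℝ Q w)) w :=
    Complex.ofRealCLM.hasFDerivAt.comp w (hQ.contDiff.differentiable (by simp) w).hasFDerivAt
  rw [((h1.const_mul Complex.I).cexp).fderiv]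
  simp [hQ.fderiv_apply]

lemma Amplitude.hasFDerivAt_snd (hφ : IsSymbol 1 (fun q => (φ q : ℂ)))
    (hF : Amplitude φ m₁ σ F) (q w : E) :
    HasFDerivAt (fun w => F (q, w))
      ((fderiv ℝ F (q, w)).comp (ContinuousLinearMap.inr ℝ E E)) w :=
  (hF.differentiable hφ (q, w)).hasFDerivAt.comp w (hasFDerivAt_prodMk_right q w)

lemma Amplitude.hasFDerivAt_fst (hφ : IsSymbol 1 (fun q => (φ q : ℂ)))
    (hF : Amplitude φ m₁ σ F) (q w : E) :
    HasFDerivAt (fun q => F (q, w))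
      ((fderiv ℝ F (q, w)).comp (ContinuousLinearMap.inl ℝ E E)) q :=
  (hF.differentiable hφ (q, w)).hasFDerivAt.comp q (hasFDerivAt_prodMk_left q w)

variable [FiniteDimensional ℝ E] [MeasurableSpace E] [BorelSpace E]

lemma integrable_one_add_norm_add_rpow (μ : Measure E) [μ.IsAddHaarMeasure]
    (hm₁ : m₁ < -Module.finrank ℝ E) (q : E) :
    Integrable (fun w => (1 + ‖q + w‖) ^ m₁) μ := by
  have h := integrable_one_add_norm (μ := μ) (r := -m₁) (by linarith)
  simpa using h.comp_add_left q

/-- Amplitudes times weights of nonpositive order are integrable against bounded phases. -/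
lemma Amplitude.integrable_mul_weight (μ : Measure E) [μ.IsAddHaarMeasure]
    (hQ : IsQuadraticPhase Q u ℓ)
    (hφ : IsSymbol 1 (fun q => (φ q : ℂ))) (hm₁ : m₁ < -Module.finrank ℝ E)
    (hF : Amplitude φ m₁ σ F) (hρ : Weight ℓ a ρ) (ha : a ≤ 0) (q : E) :
    Integrable (fun w => Complex.exp (Complex.I * Q w) * (F (q, w) * ρ w)) μ := by
  obtain ⟨C, hC0, hC⟩ := hF.norm_le_integrable
  obtain ⟨D, hD0, hD⟩ := hρ.norm_le hQ
  refine ((integrable_one_add_norm_add_rpow μ hm₁ q).const_mul (C * D)).mono' ?_ ?_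
  · refine Continuous.aestronglyMeasurable ?_
    exact hQ.contDiff_exp.continuous.mul
      (((hF.contDiff hφ).continuous.comp (by fun_prop)).mul hρ.contDiff.continuous)
  · refine Filter.Eventually.of_forall fun w => ?_
    have hρw : ‖ρ w‖ ≤ D := (hD w).trans <| mul_le_of_le_one_right hD0 <|
      Real.rpow_le_one_of_one_le_of_nonpos (by linarith [norm_nonneg w]) ha
    rw [norm_mul, Complex.norm_exp_I_mul_ofReal, one_mul, norm_mul]
    refine (mul_le_mul (hC (q, w)) hρw (norm_nonneg _) (by positivity)).trans_eq ?_
    ring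

/-- Integration by parts in the direction `u i`. -/
lemma Amplitude.integral_mul_clm_eq (μ : Measure E) [μ.IsAddHaarMeasure]
    (hQ : IsQuadraticPhase Q u ℓ)
    (hφ : IsSymbol 1 (fun q => (φ q : ℂ))) (hm₁ : m₁ < -Module.finrank ℝ E)
    (hF : Amplitude φ m₁ σ F) (hρ : Weight ℓ a ρ) (ha : a ≤ -1) (i : ι) (q : E) :
    ∫ w, Complex.exp (Complex.I * Q w) * (F (q, w) * (ρ w * ℓ i w)) ∂μ =
      Complex.I * (∫ w, Complex.exp (Complex.I * Q w) * (fderiv ℝ F (q, w) (0, u i) * ρ w) ∂μ)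
      + Complex.I * ∫ w, Complex.exp (Complex.I * Q w) * (F (q, w) * fderiv ℝ ρ w (u i)) ∂μ := by
  have hFi := hF.fderiv_snd hφ (u i)
  have hρi := hρ.fderiv_apply (u i) rfl
  have hρℓ := hρ.mul_clm (Complex.ofRealCLM.comp (ℓ i)) rfl
  have i1 := hFi.integrable_mul_weight μ hQ hφ hm₁ hρ (by linarith) q
  have i2 := hF.integrable_mul_weight μ hQ hφ hm₁ hρi (by linarith) q
  have i3 := hF.integrable_mul_weight μ hQ hφ hm₁ hρℓ (by linarith) q
  have i4 := hF.integrable_mul_weight μ hQ hφ hm₁ hρ (by linarith) q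
  have hd : ∀ w, fderiv ℝ (fun w => F (q, w) * ρ w) w (u i) =
      fderiv ℝ F (q, w) (0, u i) * ρ w + F (q, w) * fderiv ℝ ρ w (u i) := by
    intro w
    have h : HasFDerivAt (fun w => F (q, w) * ρ w) _ w :=
      (hF.hasFDerivAt_snd hφ q w).mul (hρ.differentiable w).hasFDerivAt
    rw [h.fderiv]
    simp
    ring
  have parts := integral_mul_fderiv_eq_neg_fderiv_mul_of_integrable (μ := μ) (𝕜 := ℂ)
    (f := fun w => F (q, w) * ρ w) (g := fun w => Complex.exp (Complex.I * Q w)) (v := u i)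
    ((i1.add i2).congr (.of_forall fun w => by simp only [Pi.add_apply, hd]; ring))
    ((i3.const_mul Complex.I).congr (.of_forall fun w => by
      simp only [hQ.fderiv_exp_apply, ContinuousLinearMap.comp_apply, Complex.ofRealCLM_apply]
      ring))
    (i4.congr (.of_forall fun w => by simp only; ring))
    (fun w _ => (hF.hasFDerivAt_snd hφ q w).differentiableAt.mul (hρ.differentiable w))
    (fun w _ => hQ.contDiff_exp.differentiable (by simp) w)
  have e1 : ∫ w, (F (q, w) * ρ w) *
        fderiv ℝ (fun w => Complex.exp (Complex.I * Q w)) w (u i) ∂μ =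
      Complex.I * ∫ w, Complex.exp (Complex.I * Q w) * (F (q, w) * (ρ w * ℓ i w)) ∂μ := by
    rw [← integral_const_mul]
    refine integral_congr_ae (.of_forall fun w => ?_)
    simp only [hQ.fderiv_exp_apply]
    ring
  have e2 : ∫ w, fderiv ℝ (fun w => F (q, w) * ρ w) w (u i) *
        Complex.exp (Complex.I * Q w) ∂μ =
      (∫ w, Complex.exp (Complex.I * Q w) * (fderiv ℝ F (q, w) (0, u i) * ρ w) ∂μ)
      + ∫ w, Complex.exp (Complex.I * Q w) * (F (q, w) * fderiv ℝ ρ w (u i)) ∂μ := by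
    rw [← integral_add i1 i2]
    refine integral_congr_ae (.of_forall fun w => ?_)
    simp only [hd]
    ring
  rw [e1, e2] at parts
  linear_combination (-Complex.I) * parts +
    (∫ w, Complex.exp (Complex.I * Q w) * (F (q, w) * (ρ w * ℓ i w)) ∂μ) * Complex.I_sq

/-- The order of the amplitude bounds the oscillatory integral with any weight: repeated
integration by parts trades growth in `w` for weights of lower order. -/
lemma Amplitude.norm_integral_mul_weight_le (μ : Measure E) [μ.IsAddHaarMeasure]
    (hQ : IsQuadraticPhase Q u ℓ)
    (hφ : IsSymbol 1 (fun q => (φ q : ℂ))) (hm₁ : m₁ < -Module.finrank ℝ E) (k : ℕ)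
    (hF : Amplitude φ m₁ σ F) (hρ : Weight ℓ a ρ) (ha : a ≤ 0)
    (hk : a - k ≤ σ - Module.finrank ℝ E - 1) :
    ∃ C : ℝ, ∀ q, ‖∫ w, Complex.exp (Complex.I * Q w) * (F (q, w) * ρ w) ∂μ‖ ≤
      C * (1 + ‖q‖) ^ σ := by
  have hm₁0 : m₁ ≤ 0 := hm₁.le.trans (by simp)
  induction k generalizing F ρ a with
  | zero =>
    obtain ⟨C, hC0, hC⟩ := hF.norm_le hm₁0
    obtain ⟨D, hD0, hD⟩ := hρ.norm_le hQ
    set r : ℝ := Module.finrank ℝ E + 1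
    have hint : Integrable (fun w : E => (1 + ‖w‖) ^ (-r)) μ :=
      integrable_one_add_norm (by simp [r])
    refine ⟨C * D * ∫ w, (1 + ‖w‖) ^ (-r) ∂μ, fun q => ?_⟩
    have hle : ∀ w, ‖Complex.exp (Complex.I * Q w) * (F (q, w) * ρ w)‖ ≤
        C * D * (1 + ‖q‖) ^ σ * (1 + ‖w‖) ^ (-r) := by
      intro w
      rw [norm_mul, Complex.norm_exp_I_mul_ofReal, one_mul, norm_mul]
      calc ‖F (q, w)‖ * ‖ρ w‖
          ≤ C * ((1 + ‖q‖) ^ σ * (1 + ‖w‖) ^ (-σ)) * (D * (1 + ‖w‖) ^ a) :=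
            mul_le_mul (hC (q, w)) (hD w) (norm_nonneg _) (by positivity)
        _ = C * D * (1 + ‖q‖) ^ σ * (1 + ‖w‖) ^ (-σ + a) := by
            rw [Real.rpow_add (one_add_norm_pos w)]; ring
        _ ≤ C * D * (1 + ‖q‖) ^ σ * (1 + ‖w‖) ^ (-r) := by
            refine mul_le_mul_of_nonneg_left ?_ (by positivity)
            refine Real.rpow_le_rpow_of_exponent_le (by linarith [norm_nonneg w]) ?_
            simp only [Nat.cast_zero, sub_zero] at hk
            simp only [r]
            linarith
    refine (norm_integral_le_of_norm_le (hint.const_mul _) (.of_forall hle)).trans_eq ?_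
    rw [integral_const_mul]
    ring
  | succ k ih =>
    push_cast at hk
    have w1 : Weight ℓ (a - 2) _ := hρ.mul_inv rfl
    have w2 : ∀ i, Weight ℓ (a - 1) _ := fun i =>
      w1.mul_clm (Complex.ofRealCLM.comp (ℓ i)) (by ring)
    have w3 : ∀ i, Weight ℓ (a - 2) _ := fun i => (w2 i).fderiv_apply (u i) (by ring)
    have w4 : ∀ i, Weight ℓ a _ := fun i =>
      (w2 i).mul_clm (Complex.ofRealCLM.comp (ℓ i)) (by ring)
    obtain ⟨C, hC⟩ := ih hF w1 (by linarith) (by linarith)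
    choose D hD using fun i => ih (hF.fderiv_snd hφ (u i)) (w2 i) (by linarith) (by linarith)
    choose G hG using fun i => ih hF (w3 i) (by linarith) (by linarith)
    refine ⟨C + ∑ i, (D i + G i), fun q => ?_⟩
    have hsplit : ∀ w, Complex.exp (Complex.I * Q w) * (F (q, w) * ρ w) =
        Complex.exp (Complex.I * Q w) * (F (q, w) * (ρ w * invWeight ℓ w)) +
        ∑ i, Complex.exp (Complex.I * Q w) * (F (q, w) *
          (ρ w * invWeight ℓ w * Complex.ofRealCLM.comp (ℓ i) w *
            Complex.ofRealCLM.comp (ℓ i) w)) := by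
      intro w
      have h1 : invWeight ℓ w * (1 + ∑ i, Complex.ofRealCLM.comp (ℓ i) w ^ 2) = 1 :=
        inv_mul_cancel₀ (one_add_sum_sq_ne_zero ℓ w)
      calc _ = Complex.exp (Complex.I * Q w) * (F (q, w) * ρ w) *
            (invWeight ℓ w * (1 + ∑ i, Complex.ofRealCLM.comp (ℓ i) w ^ 2)) := by
            rw [h1, mul_one]
        _ = _ := by
            rw [mul_add, mul_add, Finset.mul_sum, Finset.mul_sum]
            refine congrArg₂ _ (by ring) (Finset.sum_congr rfl fun i _ => by ring)
    have i1 := hF.integrable_mul_weight μ hQ hφ hm₁ w1 (by linarith) q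
    have i4 := fun i => hF.integrable_mul_weight μ hQ hφ hm₁ (w4 i) ha q
    rw [integral_congr_ae (.of_forall hsplit),
      integral_add i1 (integrable_finsetSum _ fun i _ => i4 i),
      integral_finsetSum _ fun i _ => i4 i, add_mul, Finset.sum_mul]
    refine (norm_add_le _ _).trans (add_le_add (hC q) (norm_sum_le_of_le _ fun i _ => ?_))
    have hparts := hF.integral_mul_clm_eq μ hQ hφ hm₁ (w2 i) (by linarith) i q
    refine (congrArg norm hparts).trans_le ?_
    refine (norm_add_le _ _).trans ?_
    rw [norm_mul, norm_mul, Complex.norm_I, one_mul, one_mul, add_mul]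
    exact add_le_add (hD i q) (hG i q)

lemma Amplitude.norm_integral_le (μ : Measure E) [μ.IsAddHaarMeasure]
    (hQ : IsQuadraticPhase Q u ℓ)
    (hφ : IsSymbol 1 (fun q => (φ q : ℂ))) (hm₁ : m₁ < -Module.finrank ℝ E)
    (hF : Amplitude φ m₁ σ F) :
    ∃ C : ℝ, ∀ q, ‖∫ w, Complex.exp (Complex.I * Q w) * F (q, w) ∂μ‖ ≤
      C * (1 + ‖q‖) ^ σ := by
  obtain ⟨k, hk⟩ := exists_nat_ge (-(σ - Module.finrank ℝ E - 1))
  simpa using hF.norm_integral_mul_weight_le μ hQ hφ hm₁ k Weight.one le_rfl (by linarith)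

lemma Amplitude.integrable (μ : Measure E) [μ.IsAddHaarMeasure]
    (hQ : IsQuadraticPhase Q u ℓ)
    (hφ : IsSymbol 1 (fun q => (φ q : ℂ))) (hm₁ : m₁ < -Module.finrank ℝ E)
    (hF : Amplitude φ m₁ σ F) (q : E) :
    Integrable (fun w => Complex.exp (Complex.I * Q w) * F (q, w)) μ := by
  simpa using hF.integrable_mul_weight μ hQ hφ hm₁ Weight.one le_rfl q

/-- Differentiation under the oscillatory integral. -/
lemma Amplitude.hasFDerivAt_integral (μ : Measure E) [μ.IsAddHaarMeasure]
    (hQ : IsQuadraticPhase Q u ℓ)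
    (hφ : IsSymbol 1 (fun q => (φ q : ℂ))) (hm₁ : m₁ < -Module.finrank ℝ E)
    (hF : Amplitude φ m₁ σ F) (q : E) :
    ∃ A : E →L[ℝ] ℂ,
      HasFDerivAt (fun q => ∫ w, Complex.exp (Complex.I * Q w) * F (q, w) ∂μ) A q ∧
      ∀ v, A v = ∫ w, Complex.exp (Complex.I * Q w) * fderiv ℝ F (q, w) (v, 0) ∂μ := by
  have hm₁0 : m₁ ≤ 0 := hm₁.le.trans (by simp)
  let F' : E → E → E →L[ℝ] ℂ := fun q w => Complex.exp (Complex.I * Q w) •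
    (fderiv ℝ F (q, w)).comp (ContinuousLinearMap.inl ℝ E E)
  let e := Module.finBasis ℝ E
  obtain ⟨B, hB0, hB⟩ := e.exists_opNorm_le (F := ℂ)
  choose C hC0 hC using fun i => (hF.fderiv_fst hφ (e i)).norm_le_integrable
  let S : ℝ := ∑ i, C i
  have hS0 : 0 ≤ S := Finset.sum_nonneg fun i _ => hC0 i
  have hF'cont : ∀ q, Continuous (F' q) := by
    intro q
    have h1 : Continuous (fderiv ℝ F) := (hF.contDiff hφ).continuous_fderiv (by simp)
    exact hQ.contDiff_exp.continuous.smul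
      ((h1.comp (Continuous.prodMk_right q)).clm_comp continuous_const)
  have hF'norm : ∀ q w, ‖F' q w‖ ≤ B * (S * (1 + ‖q + w‖) ^ m₁) := by
    intro q w
    refine hB (by positivity) fun i => ?_
    simp only [F', FunLike.coe_smul, Pi.smul_apply, smul_eq_mul, norm_mul,
      Complex.norm_exp_I_mul_ofReal, one_mul, ContinuousLinearMap.comp_apply,
      ContinuousLinearMap.inl_apply]
    refine (hC i (q, w)).trans ?_
    gcongr
    exact Finset.single_le_sum (fun i _ => hC0 i) (Finset.mem_univ i)
  have hbound : ∀ w, ∀ x ∈ Metric.ball q 1,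
      ‖F' x w‖ ≤ B * S * 2 ^ (-m₁) * (1 + ‖q + w‖) ^ m₁ := by
    intro w x hx
    have hx' : ‖x - q‖ ≤ 1 := by rw [← dist_eq_norm]; exact (Metric.mem_ball.1 hx).le
    have h1 : (1 + ‖x + w‖) ^ m₁ ≤ (1 + ‖q + w‖) ^ m₁ * 2 ^ (-m₁) := by
      have h2 := one_add_norm_add_rpow_le (q + w) (x - q) hm₁0
      rw [show q + w + (x - q) = x + w by abel] at h2
      refine h2.trans ?_
      gcongr
      · linarith
      · linarith
    calc ‖F' x w‖ ≤ B * (S * (1 + ‖x + w‖) ^ m₁) := hF'norm x w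
      _ ≤ B * (S * ((1 + ‖q + w‖) ^ m₁ * 2 ^ (-m₁))) := by gcongr
      _ = _ := by ring
  have hbi := (integrable_one_add_norm_add_rpow μ hm₁ q).const_mul (B * S * 2 ^ (-m₁))
  refine ⟨∫ w, F' q w ∂μ, ?_, fun v => ?_⟩
  · refine hasFDerivAt_integral_of_dominated_of_fderiv_le (Metric.ball_mem_nhds q one_pos)
      (.of_forall fun x => (hF.integrable μ hQ hφ hm₁ x).aestronglyMeasurable)
      (hF.integrable μ hQ hφ hm₁ q) (hF'cont q).aestronglyMeasurable
      (.of_forall hbound) hbi (.of_forall fun w x _ => ?_)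
    exact (hF.hasFDerivAt_fst hφ x w).const_mul _
  · have hi : Integrable (F' q) μ := hbi.mono' (hF'cont q).aestronglyMeasurable
      (.of_forall fun w => hbound w q (Metric.mem_ball_self one_pos))
    rw [ContinuousLinearMap.integral_apply hi]
    simp [F']

/-- Oscillatory integrals of amplitudes are isotropic symbols of the same order. -/
theorem Amplitude.isSymbol_integral (μ : Measure E) [μ.IsAddHaarMeasure]
    (hQ : IsQuadraticPhase Q u ℓ)
    (hφ : IsSymbol 1 (fun q => (φ q : ℂ))) (hm₁ : m₁ < -Module.finrank ℝ E)
    (hF : Amplitude φ m₁ σ F) :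
    IsSymbol σ (fun q => ∫ w, Complex.exp (Complex.I * Q w) * F (q, w) ∂μ) := by
  refine isSymbol_of_graded_family
    (fun σ f => ∃ F, Amplitude φ m₁ σ F ∧
      f = fun q => ∫ w, Complex.exp (Complex.I * Q w) * F (q, w) ∂μ) ?_ ?_ ?_ ⟨F, hF, rfl⟩
  · rintro σ f ⟨F, hF, rfl⟩
    exact hF.norm_integral_le μ hQ hφ hm₁
  · rintro σ f ⟨F, hF, rfl⟩ q
    obtain ⟨A, hA, -⟩ := hF.hasFDerivAt_integral μ hQ hφ hm₁ q
    exact hA.differentiableAt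
  · rintro σ f ⟨F, hF, rfl⟩ v
    refine ⟨_, hF.fderiv_fst hφ v, funext fun q => ?_⟩
    obtain ⟨A, hA, hAv⟩ := hF.hasFDerivAt_integral μ hQ hφ hm₁ q
    rw [hA.fderiv, hAv]

end OscillatoryEstimates

/-- The pairing `(z, ξ) ↦ ⟪z, ξ⟫` is a quadratic phase. -/
lemma isQuadraticPhase_inner {d : ℕ} :
    IsQuadraticPhase (fun w : EuclideanSpace ℝ (Fin d) × EuclideanSpace ℝ (Fin d) => ⟪w.1, w.2⟫)
      (Sum.elim (fun j : Fin d => (EuclideanSpace.single j (1 : ℝ), 0))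
        (fun j : Fin d => (0, EuclideanSpace.single j (1 : ℝ))))
      (Sum.elim
        (fun j => (EuclideanSpace.proj j).comp (ContinuousLinearMap.snd ℝ _ _))
        (fun j => (EuclideanSpace.proj j).comp (ContinuousLinearMap.fst ℝ _ _))) where
  contDiff := contDiff_fst.inner ℝ contDiff_snd
  fderiv_apply := by
    rintro (j | j) w <;>
    · rw [fderiv_inner_apply ℝ differentiableAt_fst differentiableAt_snd]
      simp [fderiv_fst, fderiv_snd, EuclideanSpace.inner_single_left,
        EuclideanSpace.inner_single_right]
  lower_bound := by
    refine ⟨1 / 2, by norm_num, fun w => ?_⟩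
    have h : ∑ i, (Sum.elim
        (fun j => (EuclideanSpace.proj j).comp (ContinuousLinearMap.snd ℝ _ _))
        (fun j => (EuclideanSpace.proj j).comp (ContinuousLinearMap.fst ℝ _ _)) i) w ^ 2 =
          ‖w.2‖ ^ 2 + ‖w.1‖ ^ 2 := by
      simp [Fintype.sum_sum_type, EuclideanSpace.real_norm_sq_eq]
    have hw : ‖w‖ ^ 2 ≤ ‖w.2‖ ^ 2 + ‖w.1‖ ^ 2 := by
      rcases max_choice ‖w.1‖ ‖w.2‖ with h | h <;> rw [Prod.norm_def, h] <;>
        nlinarith [sq_nonneg ‖w.1‖, sq_nonneg ‖w.2‖]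
    rw [h]
    nlinarith [sq_nonneg (‖w‖ - 1)]

/-- Diagonal symbol estimates for the composed amplitude: with `φ₁` smooth and homogeneous
of degree 1 outside the unit ball, and `b₁, b₂` isotropic symbols of orders `m₁ < -2d` and
`m₂`, the amplitude
`b(x,y,η) = ∬ e^{i(⟨z,ξ⟩ + φ₁(y+z,η+ξ) - φ₁(y,η))} b₂(x,η) b₁(y+z,η+ξ) dz dξ`
is smooth and its diagonal pullback `(x,η) ↦ b(x,x,η)` satisfies isotropic symbol
estimates of order `m₁ + m₂`. -/
theorem statement14 (d : ℕ) (hd : 1 ≤ d) (m₁ m₂ : ℝ) (hm₁ : m₁ < -(2 * d))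
    (φ₁ : EuclideanSpace ℝ (Fin d) × EuclideanSpace ℝ (Fin d) → ℝ)
    (hφ₁smooth : ContDiff ℝ (⊤ : ℕ∞) φ₁)
    (hφ₁hom : ∀ c : ℝ, 1 ≤ c → ∀ q : EuclideanSpace ℝ (Fin d) × EuclideanSpace ℝ (Fin d),
      1 ≤ ‖q‖ → φ₁ (c • q) = c * φ₁ q)
    (b₁ b₂ : EuclideanSpace ℝ (Fin d) × EuclideanSpace ℝ (Fin d) → ℂ)
    (hb₁smooth : ContDiff ℝ (⊤ : ℕ∞) b₁) (hb₂smooth : ContDiff ℝ (⊤ : ℕ∞) b₂)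
    (hb₁ : ∀ k : ℕ, ∃ C : ℝ, ∀ q, ‖iteratedFDeriv ℝ k b₁ q‖ ≤ C * (1 + ‖q‖) ^ (m₁ - k))
    (hb₂ : ∀ k : ℕ, ∃ C : ℝ, ∀ q, ‖iteratedFDeriv ℝ k b₂ q‖ ≤ C * (1 + ‖q‖) ^ (m₂ - k))
    (b : EuclideanSpace ℝ (Fin d) → EuclideanSpace ℝ (Fin d) → EuclideanSpace ℝ (Fin d) → ℂ)
    (hb : ∀ x y η : EuclideanSpace ℝ (Fin d),
      b x y η = ∫ z : EuclideanSpace ℝ (Fin d), ∫ ξ : EuclideanSpace ℝ (Fin d),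
        Complex.exp (Complex.I * ((⟪z, ξ⟫ : ℝ) + φ₁ (y + z, η + ξ) - φ₁ (y, η))) *
          b₂ (x, η) * b₁ (y + z, η + ξ)) :
    ContDiff ℝ (⊤ : ℕ∞) (fun p : EuclideanSpace ℝ (Fin d) × EuclideanSpace ℝ (Fin d) ×
        EuclideanSpace ℝ (Fin d) => b p.1 p.2.1 p.2.2) ∧
    ∀ k : ℕ, ∃ C : ℝ, ∀ x η : EuclideanSpace ℝ (Fin d),
      ‖iteratedFDeriv ℝ k
          (fun p : EuclideanSpace ℝ (Fin d) × EuclideanSpace ℝ (Fin d) => b p.1 p.1 p.2)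
          (x, η)‖ ≤ C * (1 + ‖((x, η) : EuclideanSpace ℝ (Fin d) × EuclideanSpace ℝ (Fin d))‖) ^ (m₁ + m₂ - k) := by
  have hφ : IsSymbol 1 (fun q => (φ₁ q : ℂ)) :=
    isSymbol_of_homogeneous (Complex.ofRealCLM.contDiff.comp hφ₁smooth) fun c hc q hq => by
      simp [hφ₁hom c hc q hq]
  have hm : m₁ < -Module.finrank ℝ (EuclideanSpace ℝ (Fin d) × EuclideanSpace ℝ (Fin d)) := by
    rw [Module.finrank_prod, finrank_euclideanSpace_fin]
    push_cast
    linarith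
  let μ : Measure (EuclideanSpace ℝ (Fin d) × EuclideanSpace ℝ (Fin d)) := volume.prod volume
  have hμ : μ.IsAddHaarMeasure := Measure.prod.instIsAddHaarMeasure volume volume
  have hF := Amplitude.base (φ := φ₁) le_rfl (IsSymbol.mk hb₁smooth hb₁)
  have hB := hF.isSymbol_integral μ isQuadraticPhase_inner hφ hm
  have hint := hF.integrable μ isQuadraticPhase_inner hφ hm
  set B := fun q : EuclideanSpace ℝ (Fin d) × EuclideanSpace ℝ (Fin d) =>
    ∫ w : EuclideanSpace ℝ (Fin d) × EuclideanSpace ℝ (Fin d),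
      Complex.exp (Complex.I * ((⟪w.1, w.2⟫ : ℝ) : ℂ)) *
        (Complex.exp (Complex.I * ((φ₁ (q + w) : ℂ) - φ₁ q)) * b₁ (q + w)) ∂μ with hBdef
  have key : ∀ x y η, b x y η = b₂ (x, η) * B (y, η) := by
    intro x y η
    rw [hb, hBdef]
    simp only
    rw [integral_prod _ (hint (y, η)),
      ← integral_const_mul]
    refine integral_congr_ae (.of_forall fun z => ?_)
    simp only
    rw [← integral_const_mul]
    refine integral_congr_ae (.of_forall fun ξ => ?_)
    simp only [Prod.mk_add_mk]
    rw [add_sub_assoc, mul_add, Complex.exp_add]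
    ring
  constructor
  · simp only [key]
    exact (hb₂smooth.comp (contDiff_fst.prodMk (contDiff_snd.comp contDiff_snd))).mul
      (hB.contDiff.comp contDiff_snd)
  · intro k
    obtain ⟨C, hC⟩ := ((IsSymbol.mk hb₂smooth hb₂).mul hB).bound k
    refine ⟨C, fun x η => ?_⟩
    simp only [key]
    rw [add_comm m₁ m₂]
    exact hC (x, η)
end
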